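/- arXiv:0801.0049 — 2 statements merged into one kernel-verified Lean document; each statement's English description precedes it below -/
import Mathlib

section
/- If two horizontal loops γ₀, γ₁ : ℝ → ℝ⁴ in the standard Engel space (ℝ⁴, 𝒟) have equal rotation numbers, rot(γ₀) = rot(γ₁), then there exists a horizontal isotopy from γ₀ to γ₁. -/
/-- A horizontal loop in the standard Engel space `(ℝ⁴, 𝒟)`, where
`𝒟 = ker(dz - y dx) ∩ ker(dw - z dx)`: a smooth 1-periodic curve
`γ = (x,y,z,w)` with nowhere-vanishing derivative, injective modulo the
period, tangent to `𝒟`, i.e. `z' = y·x'` and `w' = z·x'`. -/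
structure IsHorizontalLoop (γ : ℝ → ℝ × ℝ × ℝ × ℝ) : Prop where
  smooth : ContDiff ℝ (⊤ : ℕ∞) γ
  periodic : Function.Periodic γ 1
  immersed : ∀ s : ℝ, deriv γ s ≠ 0
  tangent_z : ∀ s : ℝ, deriv (fun t => (γ t).2.2.1) s
      = (γ s).2.1 * deriv (fun t => (γ t).1) s
  tangent_w : ∀ s : ℝ, deriv (fun t => (γ t).2.2.2) s
      = (γ s).2.2.1 * deriv (fun t => (γ t).1) s
  injOnPeriod : ∀ s₀ s₁ : ℝ, γ s₀ = γ s₁ → ∃ k : ℤ, s₁ - s₀ = (k : ℝ)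

/-- `rot(γ) = n`: the winding number of `s ↦ (x'(s), y'(s))` around the origin
over one period equals `n`, expressed via a continuous angle function `θ`. -/
def HasRotationNumber (γ : ℝ → ℝ × ℝ × ℝ × ℝ) (n : ℤ) : Prop :=
  ∃ θ : ℝ → ℝ, Continuous θ ∧
    (∀ s : ℝ,
      deriv (fun t => (γ t).1) s
        = Real.sqrt ((deriv (fun t => (γ t).1) s) ^ 2
            + (deriv (fun t => (γ t).2.1) s) ^ 2) * Real.cos (θ s) ∧
      deriv (fun t => (γ t).2.1) s
        = Real.sqrt ((deriv (fun t => (γ t).1) s) ^ 2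
            + (deriv (fun t => (γ t).2.1) s) ^ 2) * Real.sin (θ s)) ∧
    θ 1 - θ 0 = 2 * Real.pi * (n : ℝ)

/-- A horizontal isotopy: a smooth map `H : [0,1] × ℝ → ℝ⁴` such that each
`H t` (for `t ∈ [0,1]`) is a horizontal loop. -/
def IsHorizontalIsotopy (H : ℝ → ℝ → ℝ × ℝ × ℝ × ℝ) : Prop :=
  ContDiffOn ℝ (⊤ : ℕ∞) (Function.uncurry H) (Set.Icc (0:ℝ) 1 ×ˢ (Set.univ : Set ℝ)) ∧
  ∀ t ∈ Set.Icc (0:ℝ) 1, IsHorizontalLoop (H t)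

open Set Filter Topology MeasureTheory
open scoped ContDiff

section ParametricIntegrals

variable {E G : Type} [NormedAddCommGroup E] [NormedSpace ℝ E] [FiniteDimensional ℝ E]
  [NormedAddCommGroup G] [NormedSpace ℝ G]

theorem hasFDerivAt_integral_unit {f : E × ℝ → G} (hf : ContDiff ℝ ∞ f) (q : E) :
    HasFDerivAt (fun q => ∫ u in (0:ℝ)..1, f (q, u))
      (∫ u in (0:ℝ)..1, (fderiv ℝ f (q, u)).comp (ContinuousLinearMap.inl ℝ E ℝ)) q := by
  have hc : Continuous fun p : E × ℝ =>
      (fderiv ℝ f p).comp (ContinuousLinearMap.inl ℝ E ℝ) := by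
    have := hf.continuous_fderiv (by simp)
    fun_prop
  have hfc := hf.continuous
  obtain ⟨C, hC⟩ := ((isCompact_closedBall q 1).prod
    (isCompact_Icc (a := (0:ℝ)) (b := 1))).bddAbove_image hc.norm.continuousOn
  refine intervalIntegral.hasFDerivAt_integral_of_dominated_of_fderiv_le (𝕜 := ℝ)
    (F := fun q u => f (q, u)) (s := Metric.closedBall q 1)
    (F' := fun q u => (fderiv ℝ f (q, u)).comp (ContinuousLinearMap.inl ℝ E ℝ))
    (bound := fun _ => C) (Metric.closedBall_mem_nhds q one_pos)
    (Eventually.of_forall fun x => ?_) ?_ ?_ (ae_of_all _ fun u hu x hx => ?_) ?_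
    (ae_of_all _ fun u hu x hx => ?_)
  · exact Continuous.aestronglyMeasurable (by fun_prop)
  · exact Continuous.intervalIntegrable (by fun_prop) _ _
  · exact (hc.comp (Continuous.prodMk_right q)).aestronglyMeasurable
  · rw [uIoc_of_le zero_le_one] at hu
    exact hC ⟨(x, u), ⟨hx, hu.1.le, hu.2⟩, rfl⟩
  · exact continuous_const.intervalIntegrable _ _
  · have h1 := (hf.differentiable (by simp) (x, u)).hasFDerivAt
    exact h1.comp x (hasFDerivAt_prodMk_left x u)

theorem contDiff_integral_unit [CompleteSpace G] {f : E × ℝ → G} (hf : ContDiff ℝ ∞ f) :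
    ContDiff ℝ ∞ (fun q => ∫ u in (0:ℝ)..1, f (q, u)) := by
  rw [contDiff_infty]
  intro n
  induction n generalizing G with
  | zero =>
    have : Differentiable ℝ (fun q => ∫ u in (0:ℝ)..1, f (q, u)) := fun q =>
      (hasFDerivAt_integral_unit hf q).differentiableAt
    exact contDiff_zero.2 this.continuous
  | succ n ih =>
    push_cast
    refine contDiff_succ_iff_hasFDerivAt.2 ⟨_, ?_, fun q => hasFDerivAt_integral_unit hf q⟩
    refine ih (f := fun p => (fderiv ℝ f p).comp (ContinuousLinearMap.inl ℝ E ℝ)) ?_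
    have : ContDiff ℝ ∞ (fderiv ℝ f) := hf.fderiv_right (by simp)
    fun_prop

theorem contDiff_primitive [CompleteSpace G] {f : E × ℝ → G} (hf : ContDiff ℝ ∞ f) :
    ContDiff ℝ ∞ (fun p : E × ℝ => ∫ u in (0:ℝ)..p.2, f (p.1, u)) := by
  have : (fun p : E × ℝ => ∫ u in (0:ℝ)..p.2, f (p.1, u)) =
      fun p => p.2 • ∫ u in (0:ℝ)..1, f (p.1, p.2 * u) := by
    ext p
    rw [intervalIntegral.smul_integral_comp_mul_left (fun u => f (p.1, u))]
    simp
  rw [this]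
  exact contDiff_snd.smul (contDiff_integral_unit
    (f := fun r : (E × ℝ) × ℝ => f (r.1.1, r.1.2 * r.2)) (by fun_prop))

theorem contDiff_deriv_snd {E G : Type} [NormedAddCommGroup E] [NormedSpace ℝ E]
    [NormedAddCommGroup G] [NormedSpace ℝ G] {f : E × ℝ → G} (hf : ContDiff ℝ ∞ f) :
    ContDiff ℝ ∞ (fun p : E × ℝ => deriv (fun u => f (p.1, u)) p.2) := by
  have : (fun p : E × ℝ => deriv (fun u => f (p.1, u)) p.2) = fun p => fderiv ℝ f p (0, 1) := by
    ext p
    have h1 := (hf.differentiable (by simp) (p.1, p.2)).hasFDerivAt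
    exact (h1.comp_hasDerivAt p.2 ((hasDerivAt_const p.2 p.1).prodMk (hasDerivAt_id p.2))).deriv
  rw [this]
  have : ContDiff ℝ ∞ (fderiv ℝ f) := hf.fderiv_right (by simp)
  fun_prop

end ParametricIntegrals

section Transversality

theorem exists_nhds_dimH_image_snd_lt {E P V : Type} [NormedAddCommGroup E] [NormedSpace ℝ E]
    [FiniteDimensional ℝ E] [NormedAddCommGroup P] [NormedSpace ℝ P] [FiniteDimensional ℝ P]
    [NormedAddCommGroup V] [NormedSpace ℝ V] [FiniteDimensional ℝ V]
    (hdim : Module.finrank ℝ E < Module.finrank ℝ V) {F : E × P → V} (hF : ContDiff ℝ ∞ F)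
    {a : E × P} (ha : F a = 0) (hsurj : (fderiv ℝ F a).range = ⊤) :
    ∃ U ∈ 𝓝 a, dimH (Prod.snd '' (U ∩ F ⁻¹' {0})) < Module.finrank ℝ P := by
  have hs : HasStrictFDerivAt F (fderiv ℝ F a) a := hF.contDiffAt.hasStrictFDerivAt (by simp)
  set g := hs.implicitFunction F (fderiv ℝ F a) hsurj (F a)
  have hg : HasStrictFDerivAt g (fderiv ℝ F a).ker.subtypeL 0 := hs.to_implicitFunction hsurj
  obtain ⟨K, S, hS, hK⟩ := hg.exists_lipschitzOnWith
  have h1 := hs.eq_implicitFunction hsurj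
  have h2 : ∀ᶠ x in 𝓝 a, (hs.implicitToOpenPartialHomeomorph F (fderiv ℝ F a) hsurj x).2 ∈ S := by
    have hc := (hs.implicitToOpenPartialHomeomorph F (fderiv ℝ F a) hsurj).continuousAt
      (hs.mem_implicitToOpenPartialHomeomorph_source hsurj)
    refine (continuousAt_snd.comp hc).eventually_mem ?_
    simpa [hs.implicitToOpenPartialHomeomorph_self hsurj] using hS
  refine ⟨_, h1.and h2, ?_⟩
  have hsub : Prod.snd '' ({x | hs.implicitFunction F (fderiv ℝ F a) hsurj (F x)
      (hs.implicitToOpenPartialHomeomorph F (fderiv ℝ F a) hsurj x).2 = x ∧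
      (hs.implicitToOpenPartialHomeomorph F (fderiv ℝ F a) hsurj x).2 ∈ S} ∩ F ⁻¹' {0})
      ⊆ (fun y => (g y).2) '' S := by
    rintro _ ⟨x, ⟨⟨hx1, hx2⟩, hx3⟩, rfl⟩
    refine ⟨_, hx2, ?_⟩
    rw [mem_preimage, mem_singleton_iff] at hx3
    rw [hx3, ← ha] at hx1
    exact congrArg Prod.snd hx1
  have hdimker : Module.finrank ℝ (fderiv ℝ F a).ker < Module.finrank ℝ P := by
    have := (fderiv ℝ F a).toLinearMap.finrank_range_add_finrank_ker
    rw [Module.finrank_prod] at this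
    have h3 : Module.finrank ℝ (fderiv ℝ F a).range = Module.finrank ℝ V := by
      rw [hsurj, finrank_top]
    change Module.finrank ℝ (fderiv ℝ F a).range + Module.finrank ℝ (fderiv ℝ F a).ker = _ at this
    omega
  calc dimH _ ≤ dimH ((fun y => (g y).2) '' S) := dimH_mono hsub
    _ ≤ dimH S := (LipschitzWith.prod_snd.comp_lipschitzOnWith hK).dimH_image_le
    _ ≤ dimH (univ : Set (fderiv ℝ F a).ker) := dimH_mono (subset_univ _)
    _ = Module.finrank ℝ (fderiv ℝ F a).ker := Real.dimH_univ_eq_finrank _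
    _ < _ := by exact_mod_cast hdimker

end Transversality

section PeriodicIntegrals

theorem integral_pos_of_periodic {f : ℝ → ℝ} (hf : Continuous f) (hp : Function.Periodic f 1)
    (h0 : ∀ s, 0 ≤ f s) {c : ℝ} (hc : 0 < f c) : 0 < ∫ s in (0:ℝ)..1, f s := by
  refine intervalIntegral.integral_pos zero_lt_one hf.continuousOn (fun s _ => h0 s)
    ⟨Int.fract c, ⟨Int.fract_nonneg c, (Int.fract_lt_one c).le⟩, ?_⟩
  have := hp.sub_zsmul_eq (x := c) ⌊c⌋
  simp only [zsmul_eq_mul, mul_one] at this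
  rwa [Int.fract, this]

theorem primitive_add_one {f : ℝ → ℝ} (hf : Continuous f) (hp : Function.Periodic f 1)
    (h0 : ∫ s in (0:ℝ)..1, f s = 0) (s : ℝ) :
    ∫ u in (0:ℝ)..(s + 1), f u = ∫ u in (0:ℝ)..s, f u := by
  rw [← intervalIntegral.integral_add_adjacent_intervals (hf.intervalIntegrable 0 s)
    (hf.intervalIntegrable s (s + 1)), hp.intervalIntegral_add_eq s 0, zero_add, h0, add_zero]

theorem hasDerivAt_primitive {f : ℝ → ℝ} (hf : Continuous f) (s : ℝ) :
    HasDerivAt (fun s => ∫ u in (0:ℝ)..s, f u) (f s) s :=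
  (hf.integral_hasStrictDerivAt 0 s).hasDerivAt

theorem Function.Periodic.exists_deriv_eq_zero_of_one {f : ℝ → ℝ} (hf : Differentiable ℝ f)
    (hp : Function.Periodic f 1) : ∃ s, deriv f s = 0 := by
  obtain ⟨s, -, hs⟩ := exists_deriv_eq_zero (f := f) zero_lt_one hf.continuous.continuousOn
    (by simpa using (hp 0).symm)
  exact ⟨s, hs⟩

end PeriodicIntegrals

section RegularHomotopy

/-- `θ` takes values of both signs of the cosine. -/
def CosChangesSign (θ : ℝ → ℝ) : Prop :=
  (∃ s, 0 < Real.cos (θ s)) ∧ ∃ s, Real.cos (θ s) < 0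

theorem cosChangesSign_of_two_pi_le {θ : ℝ → ℝ} (hθ : Continuous θ) {p q : ℝ}
    (h : 2 * Real.pi ≤ θ p - θ q) : CosChangesSign θ := by
  have hpi := Real.pi_pos
  have key : ∀ v : ℝ, ∃ s, ∃ k : ℤ, θ s = v + k * (2 * Real.pi) := by
    intro v
    obtain ⟨s, hs⟩ := intermediate_value_univ q p hθ
      (show v + ⌈(θ q - v) / (2 * Real.pi)⌉ * (2 * Real.pi) ∈ Icc (θ q) (θ p) by
        have h1 := Int.le_ceil ((θ q - v) / (2 * Real.pi))
        have h2 := Int.ceil_lt_add_one ((θ q - v) / (2 * Real.pi))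
        rw [div_le_iff₀ (by positivity)] at h1
        rw [← sub_lt_iff_lt_add, lt_div_iff₀ (by positivity)] at h2
        constructor <;> linarith)
    exact ⟨s, _, hs⟩
  obtain ⟨s, k, hs⟩ := key 0
  obtain ⟨s', k', hs'⟩ := key Real.pi
  refine ⟨⟨s, ?_⟩, s', ?_⟩
  · rw [hs, Real.cos_add_int_mul_two_pi, Real.cos_zero]; norm_num
  · rw [hs', Real.cos_add_int_mul_two_pi, Real.cos_pi]; norm_num

theorem cosChangesSign_of_closed {x y r θ : ℝ → ℝ} (hx : ContDiff ℝ ∞ x) (hy : ContDiff ℝ ∞ y)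
    (hxp : Function.Periodic x 1) (hyp : Function.Periodic y 1) (hr : ∀ s, 0 < r s)
    (hx' : ∀ s, deriv x s = r s * Real.cos (θ s)) (hy' : ∀ s, deriv y s = r s * Real.sin (θ s)) :
    CosChangesSign θ := by
  have hxd : Differentiable ℝ x := hx.differentiable (by simp)
  have hconst : ¬ ∀ s, deriv x s = 0 := by
    intro h
    obtain ⟨s, hs⟩ := hyp.exists_deriv_eq_zero_of_one (hy.differentiable (by simp))
    have h1 := h s
    rw [hx', mul_eq_zero, or_iff_right (hr s).ne'] at h1
    rw [hy', mul_eq_zero, or_iff_right (hr s).ne'] at hs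
    have := Real.sin_sq_add_cos_sq (θ s)
    simp [h1, hs] at this
  have hzero : ∫ s in (0:ℝ)..1, deriv x s = 0 := by
    rw [intervalIntegral.integral_deriv_eq_sub (fun s _ => hxd s)
      ((hx.continuous_deriv (by simp)).intervalIntegrable _ _)]
    simpa [sub_eq_zero] using hxp 0
  have hdp : Function.Periodic (deriv x) 1 := fun s => by
    rw [← deriv_comp_add_const, show (fun s => x (s + 1)) = x from funext hxp]
  have hdc : Continuous (deriv x) := hx.continuous_deriv (by simp)
  push Not at hconst
  obtain ⟨c, hc⟩ := hconst
  constructor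
  · by_contra! h
    have h1 : ∀ s, deriv x s ≤ 0 := fun s => by
      rw [hx']; exact mul_nonpos_of_nonneg_of_nonpos (hr s).le (h s)
    have := integral_pos_of_periodic (f := fun s => - deriv x s) hdc.neg
      (fun s => by simp [hdp s]) (fun s => by simpa using h1 s) (c := c)
      (by simpa using lt_of_le_of_ne (h1 c) hc)
    simp [hzero] at this
  · by_contra! h
    have h1 : ∀ s, 0 ≤ deriv x s := fun s => by
      rw [hx']; exact mul_nonneg (hr s).le (h s)
    have := integral_pos_of_periodic hdc hdp h1 (lt_of_le_of_ne (h1 c) hc.symm)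
    simp [hzero] at this

/-- A smooth family of angle functions is realized by a smooth family of closed plane curves. -/
theorem exists_closed_curves_of_angle {Θ : ℝ × ℝ → ℝ} (hΘ : ContDiff ℝ ∞ Θ) {n : ℤ}
    (hp : ∀ t s, Θ (t, s + 1) = Θ (t, s) + n * (2 * Real.pi))
    (hc : ∀ t, CosChangesSign fun s => Θ (t, s)) :
    ∃ X Y R : ℝ × ℝ → ℝ, ∃ C : ℝ → ℝ, ContDiff ℝ ∞ X ∧ ContDiff ℝ ∞ Y ∧
      (∀ t s, X (t, s + 1) = X (t, s)) ∧ (∀ t s, Y (t, s + 1) = Y (t, s)) ∧ (∀ q, 0 < R q) ∧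
      (∀ t s, HasDerivAt (fun s => X (t, s)) (R (t, s) * Real.cos (Θ (t, s))) s) ∧
      ∀ t s, HasDerivAt (fun s => Y (t, s))
        (Real.sin (Θ (t, s)) - C t * Real.cos (Θ (t, s)) ^ 2) s := by
  have hcos : ∀ t s, Real.cos (Θ (t, s + 1)) = Real.cos (Θ (t, s)) := fun t s => by
    rw [hp, Real.cos_add_int_mul_two_pi]
  have hsin : ∀ t s, Real.sin (Θ (t, s + 1)) = Real.sin (Θ (t, s)) := fun t s => by
    rw [hp, Real.sin_add_int_mul_two_pi]
  have hglue : ContDiff ℝ ∞ expNegInvGlue := expNegInvGlue.contDiff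
  have hΘc := hΘ.continuous
  have hgluec := hglue.continuous
  set m : ℝ → ℝ := fun t => ∫ s in (0:ℝ)..1, Real.cos (Θ (t, s))
  set P : ℝ → ℝ := fun t => ∫ s in (0:ℝ)..1, expNegInvGlue (Real.cos (Θ (t, s))) * Real.cos (Θ (t, s))
  set N : ℝ → ℝ := fun t =>
    ∫ s in (0:ℝ)..1, expNegInvGlue (-Real.cos (Θ (t, s))) * -Real.cos (Θ (t, s))
  set S : ℝ → ℝ := fun t => ∫ s in (0:ℝ)..1, Real.sin (Θ (t, s))
  set Q : ℝ → ℝ := fun t => ∫ s in (0:ℝ)..1, Real.cos (Θ (t, s)) ^ 2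
  have hm : ContDiff ℝ ∞ m := contDiff_integral_unit (f := fun q => Real.cos (Θ q)) (by fun_prop)
  have hP : ContDiff ℝ ∞ P := contDiff_integral_unit
    (f := fun q => expNegInvGlue (Real.cos (Θ q)) * Real.cos (Θ q)) (by fun_prop)
  have hN : ContDiff ℝ ∞ N := contDiff_integral_unit
    (f := fun q => expNegInvGlue (-Real.cos (Θ q)) * -Real.cos (Θ q)) (by fun_prop)
  have hS : ContDiff ℝ ∞ S := contDiff_integral_unit (f := fun q => Real.sin (Θ q)) (by fun_prop)
  have hQ : ContDiff ℝ ∞ Q := contDiff_integral_unit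
    (f := fun q => Real.cos (Θ q) ^ 2) (by fun_prop)
  have hnn : ∀ u : ℝ, 0 ≤ expNegInvGlue u * u := fun u => by
    rcases le_total u 0 with h | h
    · simp [expNegInvGlue.zero_of_nonpos h]
    · exact mul_nonneg (expNegInvGlue.nonneg u) h
  have hPpos : ∀ t, 0 < P t := fun t => by
    obtain ⟨c, hc⟩ := (hc t).1
    exact integral_pos_of_periodic (by fun_prop) (fun s => by simp only [hcos]) (fun s => hnn _)
      (mul_pos (expNegInvGlue.pos_of_pos hc) hc)
  have hNpos : ∀ t, 0 < N t := fun t => by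
    obtain ⟨c, hc⟩ := (hc t).2
    exact integral_pos_of_periodic (by fun_prop) (fun s => by simp only [hcos]) (fun s => hnn _)
      (mul_pos (expNegInvGlue.pos_of_pos (neg_pos.2 hc)) (neg_pos.2 hc))
  have hQpos : ∀ t, 0 < Q t := fun t => by
    obtain ⟨c, hc⟩ := (hc t).1
    exact integral_pos_of_periodic (c := c) (by fun_prop) (fun s => by simp only [hcos])
      (fun s => sq_nonneg _) (by positivity)
  set α : ℝ → ℝ := fun t => (1 + m t ^ 2) / P t
  set β : ℝ → ℝ := fun t => (1 + m t + m t ^ 2) / N t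
  have hα : ContDiff ℝ ∞ α := ContDiff.div (by fun_prop) hP fun t => (hPpos t).ne'
  have hβ : ContDiff ℝ ∞ β := ContDiff.div (by fun_prop) hN fun t => (hNpos t).ne'
  set R : ℝ × ℝ → ℝ := fun q => 1 + α q.1 * expNegInvGlue (Real.cos (Θ q)) +
    β q.1 * expNegInvGlue (-Real.cos (Θ q))
  set C : ℝ → ℝ := fun t => S t / Q t
  have hC : ContDiff ℝ ∞ C := hS.div hQ fun t => (hQpos t).ne'
  have hR : ContDiff ℝ ∞ R := by fun_prop
  have hRc := hR.continuous
  refine ⟨fun q => ∫ u in (0:ℝ)..q.2, R (q.1, u) * Real.cos (Θ (q.1, u)),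
    fun q => ∫ u in (0:ℝ)..q.2, (Real.sin (Θ (q.1, u)) - C q.1 * Real.cos (Θ (q.1, u)) ^ 2), R, C,
    contDiff_primitive (f := fun q => R q * Real.cos (Θ q)) (by fun_prop),
    contDiff_primitive (f := fun q => Real.sin (Θ q) - C q.1 * Real.cos (Θ q) ^ 2) (by fun_prop),
    fun t s => ?_, fun t s => ?_, fun q => ?_, fun t s => ?_, fun t s => ?_⟩
  · refine primitive_add_one (f := fun u => R (t, u) * Real.cos (Θ (t, u))) (by fun_prop)
      (fun s => by simp only [R, hcos]) ?_ s
    have : (fun u => R (t, u) * Real.cos (Θ (t, u))) = fun u => (Real.cos (Θ (t, u)) +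
        α t * (expNegInvGlue (Real.cos (Θ (t, u))) * Real.cos (Θ (t, u)))) -
        β t * (expNegInvGlue (-Real.cos (Θ (t, u))) * -Real.cos (Θ (t, u))) := by
      ext u; simp only [R]; ring
    rw [this, intervalIntegral.integral_sub, intervalIntegral.integral_add,
      intervalIntegral.integral_const_mul, intervalIntegral.integral_const_mul]
    · change m t + α t * P t - β t * N t = 0
      simp only [α, β]
      rw [div_mul_cancel₀ _ (hPpos t).ne', div_mul_cancel₀ _ (hNpos t).ne']
      ring
    all_goals exact Continuous.intervalIntegrable (by fun_prop) _ _
  · refine primitive_add_one (f := fun u => Real.sin (Θ (t, u)) - C t * Real.cos (Θ (t, u)) ^ 2)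
      (by fun_prop) (fun s => by simp only [hcos, hsin]) ?_ s
    rw [intervalIntegral.integral_sub, intervalIntegral.integral_const_mul]
    · change S t - S t / Q t * Q t = 0
      rw [div_mul_cancel₀ _ (hQpos t).ne', sub_self]
    all_goals exact Continuous.intervalIntegrable (by fun_prop) _ _
  · have h1 := hPpos q.1
    have h2 := hNpos q.1
    have h3 := expNegInvGlue.nonneg (Real.cos (Θ q))
    have h4 := expNegInvGlue.nonneg (-Real.cos (Θ q))
    have h5 : 0 < 1 + m q.1 + m q.1 ^ 2 := by nlinarith [sq_nonneg (1 + 2 * m q.1)]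
    positivity
  · exact hasDerivAt_primitive (f := fun u => R (t, u) * Real.cos (Θ (t, u))) (by fun_prop) s
  · exact hasDerivAt_primitive
      (f := fun u => Real.sin (Θ (t, u)) - C t * Real.cos (Θ (t, u)) ^ 2) (by fun_prop) s

end RegularHomotopy

section RegularHomotopy

theorem exists_sin_sq_prod_pos (a b c d : ℝ) : ∃ p, 0 < (Real.sin (Real.pi * (p - a)) *
    Real.sin (Real.pi * (p - b)) * Real.sin (Real.pi * (p - c)) * Real.sin (Real.pi * (p - d))) ^ 2 := by
  have hcount : ∀ a : ℝ, (range fun k : ℤ => a + (k : ℝ)).Countable := fun a => countable_range _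
  obtain ⟨p, hp⟩ := ((((hcount a).union (hcount b)).union (hcount c)).union
    (hcount d)).dense_compl ℝ |>.nonempty
  have key : ∀ a, p ∉ (range fun k : ℤ => a + (k : ℝ)) → Real.sin (Real.pi * (p - a)) ≠ 0 := by
    intro a ha h
    rw [Real.sin_eq_zero_iff] at h
    obtain ⟨k, hk⟩ := h
    refine ha ⟨k, ?_⟩
    have : (k : ℝ) = p - a := by
      rw [mul_comm] at hk
      exact mul_left_cancel₀ Real.pi_ne_zero hk
    simp [this]
  simp only [mem_compl_iff, mem_union, not_or] at hp
  have := mul_ne_zero (mul_ne_zero (mul_ne_zero (key a hp.1.1.1) (key b hp.1.1.2))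
    (key c hp.1.2)) (key d hp.2)
  exact ⟨p, by positivity⟩

theorem sin_pi_mul_sub_add_one (s a : ℝ) :
    Real.sin (Real.pi * (s + 1 - a)) = -Real.sin (Real.pi * (s - a)) := by
  rw [← Real.sin_add_pi]; ring_nf

/-- Two angle functions of the same degree are joined by a smooth path, stationary near the
ends, of angle functions whose cosine changes sign. -/
theorem exists_angle_path {θ₀ θ₁ : ℝ → ℝ} (hθ₀ : ContDiff ℝ ∞ θ₀) (hθ₁ : ContDiff ℝ ∞ θ₁)
    {n : ℤ} (hp₀ : ∀ s, θ₀ (s + 1) = θ₀ s + n * (2 * Real.pi))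
    (hp₁ : ∀ s, θ₁ (s + 1) = θ₁ s + n * (2 * Real.pi))
    (hc₀ : CosChangesSign θ₀) (hc₁ : CosChangesSign θ₁) :
    ∃ Θ : ℝ × ℝ → ℝ, ContDiff ℝ ∞ Θ ∧ (∀ t s, Θ (t, s + 1) = Θ (t, s) + n * (2 * Real.pi)) ∧
      (∀ t, CosChangesSign fun s => Θ (t, s)) ∧ (∀ t ≤ 1 / 5, ∀ s, Θ (t, s) = θ₀ s) ∧
      ∀ t, 4 / 5 ≤ t → ∀ s, Θ (t, s) = θ₁ s := by
  obtain ⟨⟨a, ha⟩, b, hb⟩ := hc₀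
  obtain ⟨⟨c, hc⟩, d, hd⟩ := hc₁
  obtain ⟨p, hp⟩ := exists_sin_sq_prod_pos a b c d
  set φ : ℝ → ℝ := fun s => (Real.sin (Real.pi * (s - a)) *
    Real.sin (Real.pi * (s - b)) * Real.sin (Real.pi * (s - c)) * Real.sin (Real.pi * (s - d))) ^ 2
    with hφ
  have hφs : ContDiff ℝ ∞ φ := by fun_prop
  have hφp : ∀ s, φ (s + 1) = φ s := fun s => by
    simp only [hφ, sin_pi_mul_sub_add_one]; ring
  have hφa : φ a = 0 := by simp [hφ]
  have hφb : φ b = 0 := by simp [hφ]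
  have hφc : φ c = 0 := by simp [hφ]
  have hφd : φ d = 0 := by simp [hφ]
  set K : ℝ := (2 * Real.pi + |θ₀ p - θ₀ a| + |θ₁ p - θ₁ a|) / φ p with hK
  have hT : ContDiff ℝ ∞ Real.smoothTransition := Real.smoothTransition.contDiff
  set κ : ℝ → ℝ := fun t => Real.smoothTransition (5 * t - 1) * Real.smoothTransition (4 - 5 * t)
  set τ : ℝ → ℝ := fun t => Real.smoothTransition (5 * t - 2)
  have hκ : ContDiff ℝ ∞ κ := by fun_prop
  have hτ : ContDiff ℝ ∞ τ := by fun_prop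
  have hτ0 : ∀ t ≤ 2 / 5, τ t = 0 := fun t ht =>
    Real.smoothTransition.zero_of_nonpos (by linarith)
  have hτ1 : ∀ t, 3 / 5 ≤ t → τ t = 1 := fun t ht =>
    Real.smoothTransition.one_of_one_le (by linarith)
  refine ⟨fun q => (1 - τ q.1) * θ₀ q.2 + τ q.1 * θ₁ q.2 + K * κ q.1 * φ q.2, by fun_prop,
    fun t s => ?_, fun t => ?_, fun t ht s => ?_, fun t ht s => ?_⟩
  · simp only [hp₀, hp₁, hφp]; ring
  · rcases le_total t (2 / 5) with h1 | h1
    · exact ⟨⟨a, by simpa [hτ0 t h1, hφa] using ha⟩, b, by simpa [hτ0 t h1, hφb] using hb⟩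
    rcases le_total (3 / 5) t with h2 | h2
    · exact ⟨⟨c, by simpa [hτ1 t h2, hφc] using hc⟩, d, by simpa [hτ1 t h2, hφd] using hd⟩
    · have hκ1 : κ t = 1 := by
        simp only [κ]
        rw [Real.smoothTransition.one_of_one_le (by linarith),
          Real.smoothTransition.one_of_one_le (by linarith), one_mul]
      have hθ₀c := hθ₀.continuous
      have hθ₁c := hθ₁.continuous
      have hφc := hφs.continuous
      refine cosChangesSign_of_two_pi_le (by fun_prop) (p := p) (q := a) ?_
      have hKp : K * φ p = 2 * Real.pi + |θ₀ p - θ₀ a| + |θ₁ p - θ₁ a| :=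
        div_mul_cancel₀ _ hp.ne'
      have h3 : 0 ≤ τ t := Real.smoothTransition.nonneg _
      have h4 : τ t ≤ 1 := Real.smoothTransition.le_one _
      simp only [hκ1, hφa, mul_one, mul_zero, add_zero, hKp]
      nlinarith [neg_abs_le (θ₀ p - θ₀ a), neg_abs_le (θ₁ p - θ₁ a), abs_nonneg (θ₀ p - θ₀ a),
        abs_nonneg (θ₁ p - θ₁ a)]
  · have : κ t = 0 := by
      simp only [κ]
      rw [Real.smoothTransition.zero_of_nonpos (by linarith), zero_mul]
    simp [this, hτ0 t (by linarith)]
  · have : κ t = 0 := by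
      simp only [κ]
      rw [Real.smoothTransition.zero_of_nonpos (x := 4 - 5 * t) (by linarith), mul_zero]
    simp [this, hτ1 t (by linarith)]

/-- The Whitney–Graustein theorem. -/
theorem exists_regular_homotopy {x₀ y₀ r₀ θ₀ x₁ y₁ r₁ θ₁ : ℝ → ℝ}
    (hx₀ : ContDiff ℝ ∞ x₀) (hy₀ : ContDiff ℝ ∞ y₀) (hx₁ : ContDiff ℝ ∞ x₁)
    (hy₁ : ContDiff ℝ ∞ y₁) (hθ₀ : ContDiff ℝ ∞ θ₀) (hθ₁ : ContDiff ℝ ∞ θ₁)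
    (hxp₀ : Function.Periodic x₀ 1) (hyp₀ : Function.Periodic y₀ 1)
    (hxp₁ : Function.Periodic x₁ 1) (hyp₁ : Function.Periodic y₁ 1)
    (hr₀ : ∀ s, 0 < r₀ s) (hr₁ : ∀ s, 0 < r₁ s)
    (hx₀' : ∀ s, deriv x₀ s = r₀ s * Real.cos (θ₀ s))
    (hy₀' : ∀ s, deriv y₀ s = r₀ s * Real.sin (θ₀ s))
    (hx₁' : ∀ s, deriv x₁ s = r₁ s * Real.cos (θ₁ s))
    (hy₁' : ∀ s, deriv y₁ s = r₁ s * Real.sin (θ₁ s))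
    {n : ℤ} (hp₀ : ∀ s, θ₀ (s + 1) = θ₀ s + n * (2 * Real.pi))
    (hp₁ : ∀ s, θ₁ (s + 1) = θ₁ s + n * (2 * Real.pi)) :
    ∃ X Y : ℝ × ℝ → ℝ, ContDiff ℝ ∞ X ∧ ContDiff ℝ ∞ Y ∧
      (∀ t s, X (t, s + 1) = X (t, s)) ∧ (∀ t s, Y (t, s + 1) = Y (t, s)) ∧
      (∀ t s, deriv (fun s => X (t, s)) s = 0 → deriv (fun s => Y (t, s)) s ≠ 0) ∧
      (∀ s, X (0, s) = x₀ s) ∧ (∀ s, Y (0, s) = y₀ s) ∧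
      (∀ s, X (1, s) = x₁ s) ∧ ∀ s, Y (1, s) = y₁ s := by
  obtain ⟨Θ, hΘ, hΘp, hΘc, hΘ0, hΘ1⟩ := exists_angle_path hθ₀ hθ₁ hp₀ hp₁
    (cosChangesSign_of_closed hx₀ hy₀ hxp₀ hyp₀ hr₀ hx₀' hy₀')
    (cosChangesSign_of_closed hx₁ hy₁ hxp₁ hyp₁ hr₁ hx₁' hy₁')
  obtain ⟨X, Y, R, C, hX, hY, hXp, hYp, hR, hX', hY'⟩ := exists_closed_curves_of_angle hΘ hΘp hΘc
  have hT : ContDiff ℝ ∞ Real.smoothTransition := Real.smoothTransition.contDiff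
  set a : ℝ → ℝ := fun t => 1 - Real.smoothTransition (5 * t) with ha
  set b : ℝ → ℝ := fun t => Real.smoothTransition (5 * t - 4) with hb
  have has : ContDiff ℝ ∞ a := by fun_prop
  have hbs : ContDiff ℝ ∞ b := by fun_prop
  have ha0 : ∀ t, 0 ≤ a t := fun t => sub_nonneg.2 (Real.smoothTransition.le_one _)
  have ha1 : ∀ t, a t ≤ 1 := fun t => sub_le_self _ (Real.smoothTransition.nonneg _)
  have hb0 : ∀ t, 0 ≤ b t := fun t => Real.smoothTransition.nonneg _
  have hb1 : ∀ t, b t ≤ 1 := fun t => Real.smoothTransition.le_one _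
  have haz : ∀ t, 1 / 5 ≤ t → a t = 0 := fun t ht => by
    simp only [ha]; rw [Real.smoothTransition.one_of_one_le (by linarith), sub_self]
  have hbz : ∀ t ≤ 4 / 5, b t = 0 := fun t ht =>
    Real.smoothTransition.zero_of_nonpos (by linarith)
  have hx₀d : ∀ s, HasDerivAt x₀ (r₀ s * Real.cos (θ₀ s)) s := fun s => by
    rw [← hx₀']; exact (hx₀.differentiable (by simp) s).hasDerivAt
  have hy₀d : ∀ s, HasDerivAt y₀ (r₀ s * Real.sin (θ₀ s)) s := fun s => by
    rw [← hy₀']; exact (hy₀.differentiable (by simp) s).hasDerivAt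
  have hx₁d : ∀ s, HasDerivAt x₁ (r₁ s * Real.cos (θ₁ s)) s := fun s => by
    rw [← hx₁']; exact (hx₁.differentiable (by simp) s).hasDerivAt
  have hy₁d : ∀ s, HasDerivAt y₁ (r₁ s * Real.sin (θ₁ s)) s := fun s => by
    rw [← hy₁']; exact (hy₁.differentiable (by simp) s).hasDerivAt
  have hpos : ∀ u v w : ℝ, 0 ≤ u → u ≤ 1 → 0 < v → 0 < w → 0 < u * v + (1 - u) * w := by
    intro u v w hu hu1 hv hw
    rcases hu.eq_or_lt with rfl | hu
    · simpa
    · have := mul_pos hu hv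
      have := mul_nonneg (sub_nonneg.2 hu1) hw.le
      linarith
  have hsin : ∀ v : ℝ, Real.cos v = 0 → Real.sin v ≠ 0 := fun v hc hs => by
    have := Real.sin_sq_add_cos_sq v
    simp [hc, hs] at this
  refine ⟨fun q => a q.1 * x₀ q.2 + b q.1 * x₁ q.2 + (1 - a q.1 - b q.1) * X q,
    fun q => a q.1 * y₀ q.2 + b q.1 * y₁ q.2 + (1 - a q.1 - b q.1) * Y q,
    by fun_prop, by fun_prop, fun t s => ?_, fun t s => ?_, fun t s => ?_, fun s => ?_, fun s => ?_,
    fun s => ?_, fun s => ?_⟩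
  · simp only [hxp₀ s, hxp₁ s, hXp]
  · simp only [hyp₀ s, hyp₁ s, hYp]
  · rw [((((hx₀d s).const_mul (a t)).fun_add ((hx₁d s).const_mul (b t))).fun_add
      ((hX' t s).const_mul (1 - a t - b t))).deriv,
      ((((hy₀d s).const_mul (a t)).fun_add ((hy₁d s).const_mul (b t))).fun_add
      ((hY' t s).const_mul (1 - a t - b t))).deriv]
    rcases le_total t (1 / 5) with h1 | h1
    · rw [hbz t (by linarith), hΘ0 t h1]
      intro h
      have hcz : Real.cos (θ₀ s) = 0 := by
        refine (mul_eq_zero.1 ?_).resolve_left (hpos (a t) _ _ (ha0 t) (ha1 t) (hr₀ s) (hR (t, s))).ne'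
        linear_combination h
      rw [hcz]
      convert mul_ne_zero (hpos (a t) _ _ (ha0 t) (ha1 t) (hr₀ s) one_pos).ne' (hsin _ hcz) using 1
      ring
    rcases le_total (4 / 5) t with h2 | h2
    · rw [haz t (by linarith), hΘ1 t h2]
      intro h
      have hcz : Real.cos (θ₁ s) = 0 := by
        refine (mul_eq_zero.1 ?_).resolve_left (hpos (b t) _ _ (hb0 t) (hb1 t) (hr₁ s) (hR (t, s))).ne'
        linear_combination h
      rw [hcz]
      convert mul_ne_zero (hpos (b t) _ _ (hb0 t) (hb1 t) (hr₁ s) one_pos).ne' (hsin _ hcz) using 1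
      ring
    · rw [haz t h1, hbz t h2]
      intro h
      have hcz : Real.cos (Θ (t, s)) = 0 := by
        refine (mul_eq_zero.1 ?_).resolve_left (hR (t, s)).ne'
        linear_combination h
      rw [hcz]
      convert hsin _ hcz using 1
      ring
  all_goals norm_num [ha, hb, Real.smoothTransition.zero_of_nonpos, Real.smoothTransition.one_of_one_le]

end RegularHomotopy

section MomentCorrection

/-- The Gram integrals `∮ xⁱ x'⁴`. -/
noncomputable def gram (x : ℝ → ℝ) (i : ℕ) : ℝ := ∫ s in (0:ℝ)..1, x s ^ i * deriv x s ^ 4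

/-- The Gram determinant of `1, x` with respect to the weight `x'⁴`. -/
noncomputable def gramDet (x : ℝ → ℝ) : ℝ := gram x 0 * gram x 2 - gram x 1 ^ 2

/-- The partial moments `∫₀ˢ xⁱ g dx`. -/
noncomputable def moment (x g : ℝ → ℝ) (i : ℕ) (s : ℝ) : ℝ :=
  ∫ u in (0:ℝ)..s, g u * (x u ^ i * deriv x u)

/-- A multiple of `g` corrected by a combination of `x'³` and `x x'³` so that its first two
moments over a period vanish. -/
noncomputable def correct (x g : ℝ → ℝ) (s : ℝ) : ℝ :=
  gramDet x * g s + (moment x g 1 1 * gram x 1 - moment x g 0 1 * gram x 2) * deriv x s ^ 3 +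
    (moment x g 0 1 * gram x 1 - moment x g 1 1 * gram x 0) * (x s * deriv x s ^ 3)

variable {x g : ℝ → ℝ}

theorem ContDiff.deriv_infty (hx : ContDiff ℝ ∞ x) : ContDiff ℝ ∞ (deriv x) :=
  (contDiff_infty_iff_deriv.1 hx).2

theorem Function.Periodic.deriv_one (hp : Function.Periodic x 1) :
    Function.Periodic (deriv x) 1 := fun s => by
  rw [← deriv_comp_add_const, show (fun s => x (s + 1)) = x from funext hp]

theorem contDiff_correct (hx : ContDiff ℝ ∞ x) (hg : ContDiff ℝ ∞ g) :
    ContDiff ℝ ∞ (correct x g) := by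
  have := hx.deriv_infty
  unfold correct
  fun_prop

theorem periodic_correct (hx : Function.Periodic x 1) (hg : Function.Periodic g 1) :
    Function.Periodic (correct x g) 1 := fun s => by
  simp only [correct, hx s, hg s, hx.deriv_one s]

theorem moment_correct (hx : ContDiff ℝ ∞ x) (hg : Continuous g) (i : ℕ) :
    moment x (correct x g) i 1 = gramDet x * moment x g i 1 +
      (moment x g 1 1 * gram x 1 - moment x g 0 1 * gram x 2) * gram x i +
      (moment x g 0 1 * gram x 1 - moment x g 1 1 * gram x 0) * gram x (i + 1) := by
  have hd := hx.deriv_infty.continuous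
  have hc := hx.continuous
  have : ∀ u, correct x g u * (x u ^ i * deriv x u) = gramDet x * (g u * (x u ^ i * deriv x u)) +
      (moment x g 1 1 * gram x 1 - moment x g 0 1 * gram x 2) * (x u ^ i * deriv x u ^ 4) +
      (moment x g 0 1 * gram x 1 - moment x g 1 1 * gram x 0) *
        (x u ^ (i + 1) * deriv x u ^ 4) := by
    intro u; simp only [correct]; ring
  rw [moment]
  simp only [this]
  rw [intervalIntegral.integral_add, intervalIntegral.integral_add,
    intervalIntegral.integral_const_mul, intervalIntegral.integral_const_mul,
    intervalIntegral.integral_const_mul]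
  · rfl
  all_goals exact Continuous.intervalIntegrable (by fun_prop) _ _

theorem moment_correct_zero (hx : ContDiff ℝ ∞ x) (hg : Continuous g) :
    moment x (correct x g) 0 1 = 0 := by
  rw [moment_correct hx hg, gramDet]; ring

theorem moment_correct_one (hx : ContDiff ℝ ∞ x) (hg : Continuous g) :
    moment x (correct x g) 1 1 = 0 := by
  rw [moment_correct hx hg, gramDet]; ring

theorem moment_add_smul {h : ℝ → ℝ} (hx : ContDiff ℝ ∞ x) (hg : Continuous g) (hh : Continuous h)
    (c : ℝ) (i : ℕ) (s : ℝ) :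
    moment x (fun u => g u + c * h u) i s = moment x g i s + c * moment x h i s := by
  have hd := hx.deriv_infty.continuous
  have hc := hx.continuous
  simp only [moment]
  rw [← intervalIntegral.integral_const_mul, ← intervalIntegral.integral_add]
  · congr 1; ext u; ring
  all_goals exact Continuous.intervalIntegrable (by fun_prop) _ _

theorem correct_add_smul {h : ℝ → ℝ} (hx : ContDiff ℝ ∞ x) (hg : Continuous g) (hh : Continuous h)
    (c : ℝ) (s : ℝ) :
    correct x (fun u => g u + c * h u) s = correct x g s + c * correct x h s := by
  simp only [correct, moment_add_smul hx hg hh]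
  ring

theorem correct_eq_of_moment_eq_zero {y : ℝ → ℝ} (hdet : gramDet x ≠ 0)
    (h0 : moment x y 0 1 = 0) (h1 : moment x y 1 1 = 0) :
    correct x (fun s => y s / gramDet x) = y := by
  have : ∀ i, moment x (fun s => y s / gramDet x) i 1 = moment x y i 1 / gramDet x := by
    intro i
    simp only [moment, div_mul_eq_mul_div]
    rw [intervalIntegral.integral_div]
  ext s
  simp only [correct, this, h0, h1]
  field_simp
  ring

theorem deriv_correct (hx : ContDiff ℝ ∞ x) (hg : Differentiable ℝ g) {s : ℝ}
    (hs : deriv x s = 0) : deriv (correct x g) s = gramDet x * deriv g s := by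
  have hd : HasDerivAt (deriv x) (deriv (deriv x) s) s :=
    (hx.deriv_infty.differentiable (by simp) s).hasDerivAt
  have hx' : HasDerivAt x (deriv x s) s := (hx.differentiable (by simp) s).hasDerivAt
  refine (((((hg s).hasDerivAt.const_mul (gramDet x)).add
    ((hd.fun_pow 3).const_mul (moment x g 1 1 * gram x 1 - moment x g 0 1 * gram x 2))).add
    ((hx'.mul (hd.fun_pow 3)).const_mul
      (moment x g 0 1 * gram x 1 - moment x g 1 1 * gram x 0))).deriv).trans ?_
  simp [hs]

theorem gramDet_pos (hx : ContDiff ℝ ∞ x) (hp : Function.Periodic x 1)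
    (hne : ∃ s, deriv x s ≠ 0) : 0 < gramDet x := by
  obtain ⟨c, hc⟩ := hne
  have hd := hx.deriv_infty.continuous
  have hxc := hx.continuous
  have hpd := hp.deriv_one
  have h0 : 0 < gram x 0 := by
    refine integral_pos_of_periodic (c := c) (by fun_prop) (fun s => ?_) (fun s => ?_) ?_
    · simp only [hp s, hpd s]
    · positivity
    · simp only [pow_zero, one_mul]; positivity
  set m := gram x 1 / gram x 0 with hm
  have hnear : ∀ᶠ s in 𝓝 c, deriv x s ≠ 0 := hd.continuousAt.eventually_ne hc
  have hex : ∃ s, deriv x s ≠ 0 ∧ x s ≠ m := by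
    by_contra! h
    have h1 : x =ᶠ[𝓝 c] fun _ => m := hnear.mono fun s hs => h s hs
    exact hc (by rw [h1.deriv_eq]; simp)
  obtain ⟨e, he, hem⟩ := hex
  have h1 : 0 < ∫ s in (0:ℝ)..1, (x s - m) ^ 2 * deriv x s ^ 4 := by
    refine integral_pos_of_periodic (c := e) (by fun_prop) (fun s => ?_) (fun s => ?_) ?_
    · simp only [hp s, hpd s]
    · positivity
    · have := sub_ne_zero.2 hem
      positivity
  have h2 : ∫ s in (0:ℝ)..1, (x s - m) ^ 2 * deriv x s ^ 4 =
      gram x 2 - 2 * m * gram x 1 + m ^ 2 * gram x 0 := by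
    simp only [gram]
    rw [← intervalIntegral.integral_const_mul, ← intervalIntegral.integral_const_mul,
      ← intervalIntegral.integral_sub, ← intervalIntegral.integral_add]
    · congr 1; ext s; ring
    all_goals exact Continuous.intervalIntegrable (by fun_prop) _ _
  have h3 : gramDet x = gram x 0 * ∫ s in (0:ℝ)..1, (x s - m) ^ 2 * deriv x s ^ 4 := by
    rw [h2, gramDet, hm]; field_simp; ring
  rw [h3]; positivity

end MomentCorrection

section Spanning

theorem exists_periodic_bump {c d : ℝ} (h1 : c < d) (h2 : d < c + 1) :
    ∃ ψ : ℝ → ℝ, ContDiff ℝ ∞ ψ ∧ Function.Periodic ψ 1 ∧ (∀ s ∈ Ioo c d, 0 < ψ s) ∧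
      (∀ s, 0 ≤ ψ s) ∧ ∀ s ∈ Icc d (c + 1), ψ s = 0 := by
  have hglue : ContDiff ℝ ∞ expNegInvGlue := expNegInvGlue.contDiff
  have hpi := Real.pi_pos
  refine ⟨fun s => expNegInvGlue (-(Real.sin (Real.pi * (s - c)) * Real.sin (Real.pi * (s - d)))),
    by fun_prop, fun s => ?_, fun s hs => ?_, fun s => expNegInvGlue.nonneg _, fun s hs => ?_⟩
  · simp only [sin_pi_mul_sub_add_one, neg_mul_neg]
  · refine expNegInvGlue.pos_of_pos (neg_pos.2 (mul_neg_of_pos_of_neg ?_ ?_))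
    · exact Real.sin_pos_of_pos_of_lt_pi (by nlinarith [hs.1]) (by nlinarith [hs.1, hs.2])
    · exact Real.sin_neg_of_neg_of_neg_pi_lt (by nlinarith [hs.2]) (by nlinarith [hs.1, hs.2])
  · refine expNegInvGlue.zero_of_nonpos (neg_nonpos.2 (mul_nonneg ?_ ?_))
    · exact Real.sin_nonneg_of_nonneg_of_le_pi (by nlinarith [hs.1]) (by nlinarith [hs.2])
    · exact Real.sin_nonneg_of_nonneg_of_le_pi (by nlinarith [hs.1]) (by nlinarith [hs.2])

theorem affine_eq_zero_of_mul_deriv_eq_zero {x : ℝ → ℝ} (hx : ContDiff ℝ ∞ x) {a b c α β : ℝ}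
    (hc : c ∈ Ioo a b) (hxc : deriv x c ≠ 0)
    (h : ∀ s ∈ Ioo a b, (α + β * x s) * deriv x s = 0) : α = 0 ∧ β = 0 := by
  have h1 : (fun s => α + β * x s) =ᶠ[𝓝 c] fun _ => 0 := by
    filter_upwards [hx.deriv_infty.continuous.continuousAt.eventually_ne hxc,
      Ioo_mem_nhds hc.1 hc.2] with s hs hs'
    exact (mul_eq_zero.1 (h s hs')).resolve_right hs
  have hd : HasDerivAt x (deriv x c) c := (hx.differentiable (by simp) c).hasDerivAt
  have h2 := h1.deriv_eq
  rw [((hd.const_mul β).const_add α).deriv] at h2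
  simp only [deriv_const', mul_eq_zero, hxc, or_false] at h2
  have h3 := h1.self_of_nhds
  simp only [h2, zero_mul, add_zero] at h3
  exact ⟨h3, h2⟩

/-- If a periodic density integrates to zero against all test functions supported in an arc, it
vanishes on that arc. -/
theorem eq_zero_of_forall_integral_eq_zero {u : ℝ → ℝ} (hu : ContDiff ℝ ∞ u)
    (hup : Function.Periodic u 1) {c d : ℝ} (h1 : c < d) (h2 : d < c + 1)
    (h : ∀ g : ℝ → ℝ, ContDiff ℝ ∞ g → Function.Periodic g 1 → (∀ s ∈ Icc d (c + 1), g s = 0) →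
      ∫ s in c..d, g s * u s = 0) : ∀ s ∈ Ioo c d, u s = 0 := by
  obtain ⟨ψ, hψ, hψp, hψpos, hψ0, hψz⟩ := exists_periodic_bump h1 h2
  have huc := hu.continuous
  have hψc := hψ.continuous
  by_contra! hne
  obtain ⟨s, hs, hus⟩ := hne
  have h3 := h (fun s => ψ s * u s) (by fun_prop) (fun s => by simp only [hψp s, hup s])
    fun s hs => by simp only [hψz s hs, zero_mul]
  have h4 : 0 < ∫ s in c..d, ψ s * u s * u s := by
    refine intervalIntegral.integral_pos h1 (by fun_prop) (fun r _ => ?_)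
      ⟨s, Ioo_subset_Icc_self hs, ?_⟩
    · have := hψ0 r
      rw [mul_assoc]; exact mul_nonneg this (mul_self_nonneg _)
    · rw [mul_assoc]; exact mul_pos (hψpos s hs) (mul_self_pos.2 hus)
  exact h4.ne' h3

variable {x : ℝ → ℝ}

theorem moment_sub {g : ℝ → ℝ} (hx : ContDiff ℝ ∞ x) (hg : Continuous g) (i : ℕ) (a b : ℝ) :
    moment x g i b - moment x g i a = ∫ u in a..b, g u * (x u ^ i * deriv x u) := by
  have hd := hx.deriv_infty.continuous
  have hc := hx.continuous
  exact intervalIntegral.integral_interval_sub_left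
    (Continuous.intervalIntegrable (by fun_prop) _ _)
    (Continuous.intervalIntegrable (by fun_prop) _ _)

theorem moment_add_one_sub {g : ℝ → ℝ} (hx : ContDiff ℝ ∞ x) (hxp : Function.Periodic x 1)
    (hg : Continuous g) (hgp : Function.Periodic g 1) (i : ℕ) (a : ℝ) :
    moment x g i (a + 1) - moment x g i a = moment x g i 1 := by
  rw [moment_sub hx hg, moment]
  have : Function.Periodic (fun u => g u * (x u ^ i * deriv x u)) 1 := fun s => by
    simp only [hgp s, hxp s, hxp.deriv_one s]
  simpa using this.intervalIntegral_add_eq a 0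

theorem exists_int_of_trig_eq {a b : ℝ} (hc : Real.cos (2 * Real.pi * b) = Real.cos (2 * Real.pi * a))
    (hs : Real.sin (2 * Real.pi * b) = Real.sin (2 * Real.pi * a)) : ∃ k : ℤ, b - a = k := by
  have h : Real.cos (2 * Real.pi * b - 2 * Real.pi * a) = 1 := by
    rw [Real.cos_sub, hc, hs, ← sq, ← sq]; exact Real.cos_sq_add_sin_sq _
  obtain ⟨k, hk⟩ := (Real.cos_eq_one_iff _).1 h
  refine ⟨k, mul_left_cancel₀ (Real.two_pi_pos).ne' ?_⟩
  linear_combination -hk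

theorem exists_correct_pairing_ne_zero (hx : ContDiff ℝ ∞ x) (hxp : Function.Periodic x 1)
    {a b c d : ℝ} (hab : a < b) (hba : b < a + 1) (hc : c ∈ Ioo a b) (hxc : deriv x c ≠ 0)
    (hd : d ∈ Ioo b (a + 1)) (hxd : deriv x d ≠ 0) {ξ η ζ : ℝ} (hne : ¬(ξ = 0 ∧ η = 0 ∧ ζ = 0)) :
    ∃ g : ℝ → ℝ, ContDiff ℝ ∞ g ∧ Function.Periodic g 1 ∧
      ξ * (correct x g b - correct x g a) +
      η * (moment x (correct x g) 0 b - moment x (correct x g) 0 a) +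
      ζ * (moment x (correct x g) 1 b - moment x (correct x g) 1 a) ≠ 0 := by
  by_contra! h
  have hdet := gramDet_pos hx hxp ⟨c, hxc⟩
  have hx' := hx.deriv_infty
  have hxpc := hxp.deriv_one
  have hxcont := hx.continuous
  have hx'cont := hx'.continuous
  set Λ : (ℝ → ℝ) → ℝ := fun g => ξ * (g b - g a) + η * (moment x g 0 b - moment x g 0 a) +
    ζ * (moment x g 1 b - moment x g 1 a) with hΛ
  set p : ℝ → ℝ := fun s => deriv x s ^ 3
  set q : ℝ → ℝ := fun s => x s * deriv x s ^ 3
  set D := gramDet x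
  set α := gram x 1 * Λ q - gram x 2 * Λ p with hα
  set β := gram x 1 * Λ p - gram x 0 * Λ q with hβ
  have hexp : ∀ g, ContDiff ℝ ∞ g → Λ (correct x g) =
      D * Λ g + α * moment x g 0 1 + β * moment x g 1 1 := by
    intro g hg
    have e1 : correct x g = fun s => ((fun s => 0 + D * g s) s +
        (moment x g 1 1 * gram x 1 - moment x g 0 1 * gram x 2) * p s) +
        (moment x g 0 1 * gram x 1 - moment x g 1 1 * gram x 0) * q s := by
      ext s; simp only [correct, p, q, D]; ring
    have e2 : ∀ i s, moment x (correct x g) i s = D * moment x g i s +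
        (moment x g 1 1 * gram x 1 - moment x g 0 1 * gram x 2) * moment x p i s +
        (moment x g 0 1 * gram x 1 - moment x g 1 1 * gram x 0) * moment x q i s := by
      intro i s
      have hgc := hg.continuous
      rw [e1, moment_add_smul hx (by fun_prop) (by fun_prop),
        moment_add_smul hx (by fun_prop) (by fun_prop),
        moment_add_smul hx (by fun_prop) (by fun_prop)]
      simp [moment]
    simp only [hΛ, e2, hα, hβ]
    rw [show correct x g b = _ from congrFun e1 b, show correct x g a = _ from congrFun e1 a]
    simp only
    ring
  have key : ∀ g, ContDiff ℝ ∞ g → Function.Periodic g 1 → D * ξ * (g b - g a) +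
      (∫ s in a..b, g s * ((D * η + α + (D * ζ + β) * x s) * deriv x s)) +
      (∫ s in b..a + 1, g s * ((α + β * x s) * deriv x s)) = 0 := by
    intro g hg hgp
    have hgc := hg.continuous
    have h1 := hexp g hg
    rw [show Λ (correct x g) = 0 from h g hg hgp] at h1
    have e1 : ∫ s in a..b, g s * ((D * η + α + (D * ζ + β) * x s) * deriv x s) =
        (D * η + α) * (moment x g 0 b - moment x g 0 a) +
        (D * ζ + β) * (moment x g 1 b - moment x g 1 a) := by
      rw [moment_sub hx hgc, moment_sub hx hgc, ← intervalIntegral.integral_const_mul,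
        ← intervalIntegral.integral_const_mul, ← intervalIntegral.integral_add]
      · congr 1; ext s; ring
      all_goals exact Continuous.intervalIntegrable (by fun_prop) _ _
    have e2 : ∫ s in b..a + 1, g s * ((α + β * x s) * deriv x s) =
        α * (moment x g 0 (a + 1) - moment x g 0 b) +
        β * (moment x g 1 (a + 1) - moment x g 1 b) := by
      rw [moment_sub hx hgc, moment_sub hx hgc, ← intervalIntegral.integral_const_mul,
        ← intervalIntegral.integral_const_mul, ← intervalIntegral.integral_add]
      · congr 1; ext s; ring
      all_goals exact Continuous.intervalIntegrable (by fun_prop) _ _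
    have e3 := moment_add_one_sub hx hxp hgc hgp 0 a
    have e4 := moment_add_one_sub hx hxp hgc hgp 1 a
    rw [e1, e2]
    simp only [hΛ] at h1
    linear_combination -h1 + α * e3 + β * e4
  have hαβ : α = 0 ∧ β = 0 := by
    refine affine_eq_zero_of_mul_deriv_eq_zero hx hd hxd ?_
    refine eq_zero_of_forall_integral_eq_zero (u := fun s => (α + β * x s) * deriv x s)
      (by fun_prop) (fun s => by simp only [hxp s, hxpc s]) hba (by linarith)
      fun g hg hgp hz => ?_
    have hz' : ∀ s ∈ Icc a b, g s = 0 := fun s hs => by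
      rw [← hgp s]; exact hz _ ⟨by linarith [hs.1], by linarith [hs.2]⟩
    have e := key g hg hgp
    rw [hz' a ⟨le_rfl, hab.le⟩, hz' b ⟨hab.le, le_rfl⟩,
      intervalIntegral.integral_congr (g := fun _ => 0) fun s hs => by
        rw [uIcc_of_le hab.le] at hs
        simp only [hz' s hs, zero_mul]] at e
    simpa using e
  have hηζ : D * η + α = 0 ∧ D * ζ + β = 0 := by
    refine affine_eq_zero_of_mul_deriv_eq_zero hx hc hxc ?_
    refine eq_zero_of_forall_integral_eq_zero
      (u := fun s => (D * η + α + (D * ζ + β) * x s) * deriv x s)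
      (by fun_prop) (fun s => by simp only [hxp s, hxpc s]) hab hba fun g hg hgp hz => ?_
    have e := key g hg hgp
    rw [← hgp a, hz b ⟨le_rfl, hba.le⟩, hz (a + 1) ⟨hba.le, le_rfl⟩, hαβ.1, hαβ.2] at e
    simpa [hαβ.1, hαβ.2] using e
  have hη : η = 0 := by simpa [hαβ.1, hdet.ne'] using hηζ.1
  have hζ : ζ = 0 := by simpa [hαβ.2, hdet.ne'] using hηζ.2
  have hξ : ξ ≠ 0 := fun hξ => hne ⟨hξ, hη, hζ⟩
  have hg : ∀ g, ContDiff ℝ ∞ g → Function.Periodic g 1 → g b = g a := fun g hg hgp => by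
    have e := key g hg hgp
    simpa [hαβ.1, hαβ.2, hη, hζ, hξ, hdet.ne', sub_eq_zero] using e
  obtain ⟨k, hk⟩ := exists_int_of_trig_eq
    (hg (fun s => Real.cos (2 * Real.pi * s)) (by fun_prop)
      fun s => by simp only [mul_add, mul_one, Real.cos_add_two_pi])
    (hg (fun s => Real.sin (2 * Real.pi * s)) (by fun_prop)
      fun s => by simp only [mul_add, mul_one, Real.sin_add_two_pi])
  have h1 : (0 : ℝ) < k := by linarith
  have h2 : (k : ℝ) < 1 := by linarith
  norm_cast at h1 h2
  omega

end Spanning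

section Families

/-- The plane curve `(x, y)` together with its partial moments `∫ y dx` and `∫ x y dx`. -/
noncomputable def momentCurve (x y : ℝ → ℝ) (s : ℝ) : ℝ × ℝ × ℝ × ℝ :=
  (x s, y s, moment x y 0 s, moment x y 1 s)

variable {Q : Type} [NormedAddCommGroup Q] [NormedSpace ℝ Q] [FiniteDimensional ℝ Q]
  {X Y : Q × ℝ → ℝ}

theorem contDiff_moment (hX : ContDiff ℝ ∞ X) (hY : ContDiff ℝ ∞ Y) (i : ℕ) :
    ContDiff ℝ ∞ fun p : Q × ℝ => moment (fun s => X (p.1, s)) (fun s => Y (p.1, s)) i p.2 := by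
  have hd := contDiff_deriv_snd hX
  exact contDiff_primitive (f := fun p : Q × ℝ =>
    Y p * (X p ^ i * deriv (fun u => X (p.1, u)) p.2)) (by fun_prop)

theorem contDiff_moment_one (hX : ContDiff ℝ ∞ X) (hY : ContDiff ℝ ∞ Y) (i : ℕ) :
    ContDiff ℝ ∞ fun q : Q => moment (fun s => X (q, s)) (fun s => Y (q, s)) i 1 :=
  (contDiff_moment hX hY i).comp (contDiff_id.prodMk contDiff_const)

theorem contDiff_gram (hX : ContDiff ℝ ∞ X) (i : ℕ) :
    ContDiff ℝ ∞ fun q : Q => gram (fun s => X (q, s)) i := by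
  have hd := contDiff_deriv_snd hX
  exact contDiff_integral_unit (f := fun p : Q × ℝ =>
    X p ^ i * deriv (fun u => X (p.1, u)) p.2 ^ 4) (by fun_prop)

theorem contDiff_gramDet (hX : ContDiff ℝ ∞ X) :
    ContDiff ℝ ∞ fun q : Q => gramDet (fun s => X (q, s)) := by
  have h0 := contDiff_gram hX 0
  have h1 := contDiff_gram hX 1
  have h2 := contDiff_gram hX 2
  unfold gramDet
  fun_prop

theorem contDiff_correct_family (hX : ContDiff ℝ ∞ X) (hY : ContDiff ℝ ∞ Y) :
    ContDiff ℝ ∞ fun p : Q × ℝ => correct (fun s => X (p.1, s)) (fun s => Y (p.1, s)) p.2 := by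
  have hd := contDiff_deriv_snd hX
  have g0 := (contDiff_gram hX 0).comp (contDiff_fst (F := ℝ))
  have g1 := (contDiff_gram hX 1).comp (contDiff_fst (F := ℝ))
  have g2 := (contDiff_gram hX 2).comp (contDiff_fst (F := ℝ))
  have m0 := (contDiff_moment_one hX hY 0).comp (contDiff_fst (F := ℝ))
  have m1 := (contDiff_moment_one hX hY 1).comp (contDiff_fst (F := ℝ))
  have g := (contDiff_gramDet hX).comp (contDiff_fst (F := ℝ))
  exact ((g.mul hY).add (((m1.mul g1).sub (m0.mul g2)).mul (hd.pow 3))).add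
    (((m0.mul g1).sub (m1.mul g0)).mul (hX.mul (hd.pow 3)))

theorem contDiff_momentCurve (hX : ContDiff ℝ ∞ X) (hY : ContDiff ℝ ∞ Y) :
    ContDiff ℝ ∞ fun p : Q × ℝ => momentCurve (fun s => X (p.1, s)) (fun s => Y (p.1, s)) p.2 :=
  hX.prodMk (hY.prodMk ((contDiff_moment hX hY 0).prodMk (contDiff_moment hX hY 1)))

theorem periodic_momentCurve {x y : ℝ → ℝ} (hx : ContDiff ℝ ∞ x) (hxp : Function.Periodic x 1)
    (hy : Continuous y) (hyp : Function.Periodic y 1) (h0 : moment x y 0 1 = 0)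
    (h1 : moment x y 1 1 = 0) : Function.Periodic (momentCurve x y) 1 := fun s => by
  have e0 := moment_add_one_sub hx hxp hy hyp 0 s
  have e1 := moment_add_one_sub hx hxp hy hyp 1 s
  rw [h0, sub_eq_zero] at e0
  rw [h1, sub_eq_zero] at e1
  simp only [momentCurve, hxp s, hyp s, e0, e1]

end Families

section LocalInjectivity

variable {Q : Type} [NormedAddCommGroup Q] [NormedSpace ℝ Q]

theorem eventually_injective_of_deriv_ne_zero {f : Q × ℝ → ℝ} (hf : ContDiff ℝ ∞ f) {q : Q} {a : ℝ}
    (h : deriv (fun s => f (q, s)) a ≠ 0) :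
    ∀ᶠ r : Q × ℝ × ℝ in 𝓝 (q, a, a), f (r.1, r.2.2) = f (r.1, r.2.1) → r.2.2 = r.2.1 := by
  have h1 : ∀ᶠ p : Q × ℝ in 𝓝 (q, a), deriv (fun s => f (p.1, s)) p.2 ≠ 0 :=
    (contDiff_deriv_snd hf).continuous.continuousAt.eventually_ne h
  rw [nhds_prod_eq] at h1
  obtain ⟨U, hU, V, hV, hUV⟩ := mem_prod_iff.1 h1
  obtain ⟨ε, hε, hεV⟩ := Metric.mem_nhds_iff.1 hV
  have hB : Metric.ball a ε ∈ 𝓝 a := Metric.ball_mem_nhds a hε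
  filter_upwards [prod_mem_nhds hU (prod_mem_nhds hB hB)] with r hr heq
  by_contra hne
  have hconv : Convex ℝ (Metric.ball a ε) := convex_ball a ε
  have hdiff : ∀ s, DifferentiableAt ℝ (fun s => f (r.1, s)) s := fun s =>
    ((hf.comp (contDiff_const.prodMk contDiff_id)).differentiable (by simp)) s
  have hcont : Continuous fun s => f (r.1, s) := hf.continuous.comp (by fun_prop)
  have key : ∀ u v, u ∈ Metric.ball a ε → v ∈ Metric.ball a ε → u < v →
      f (r.1, u) = f (r.1, v) → False := by
    intro u v hu hv huv he
    obtain ⟨c, hc, hc'⟩ := exists_deriv_eq_zero huv hcont.continuousOn he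
    exact hUV (mk_mem_prod hr.1 (hεV (hconv.ordConnected.out hu hv ⟨hc.1.le, hc.2.le⟩))) hc'
  rcases lt_or_gt_of_ne hne with h | h
  · exact key _ _ hr.2.2 hr.2.1 h heq
  · exact key _ _ hr.2.1 hr.2.2 h heq.symm

theorem eventually_int_sub_of_eq {C : Q × ℝ → ℝ × ℝ × ℝ × ℝ} (hC : ContDiff ℝ ∞ C) {q : Q} {a b : ℝ}
    (hp1 : ∀ q, Function.Periodic (fun s => (C (q, s)).1) 1)
    (hp2 : ∀ q, Function.Periodic (fun s => (C (q, s)).2.1) 1)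
    (himm : deriv (fun s => (C (q, s)).1) a = 0 → deriv (fun s => (C (q, s)).2.1) a ≠ 0)
    (hinj : C (q, b) = C (q, a) → ∃ k : ℤ, b - a = k) :
    ∀ᶠ r : Q × ℝ × ℝ in 𝓝 (q, a, b),
      C (r.1, r.2.2) = C (r.1, r.2.1) → ∃ k : ℤ, r.2.2 - r.2.1 = k := by
  have hcont := hC.continuous
  by_cases hne : C (q, b) = C (q, a)
  swap
  · have : ∀ᶠ r : Q × ℝ × ℝ in 𝓝 (q, a, b), C (r.1, r.2.2) ≠ C (r.1, r.2.1) :=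
      (isOpen_ne_fun (f := fun r : Q × ℝ × ℝ => C (r.1, r.2.2))
        (g := fun r : Q × ℝ × ℝ => C (r.1, r.2.1)) (by fun_prop) (by fun_prop)).mem_nhds hne
    exact this.mono fun r h h' => absurd h' h
  obtain ⟨k, hk⟩ := hinj hne
  have htend : Tendsto (fun r : Q × ℝ × ℝ => (r.1, r.2.1, r.2.2 - k)) (𝓝 (q, a, b))
      (𝓝 (q, a, a)) := by
    have : Continuous fun r : Q × ℝ × ℝ => (r.1, r.2.1, r.2.2 - (k : ℝ)) := by fun_prop
    have h2 := this.tendsto (q, a, b)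
    simpa [show b - (k : ℝ) = a by linarith] using h2
  by_cases h1 : deriv (fun s => (C (q, s)).1) a = 0
  · have := htend.eventually (eventually_injective_of_deriv_ne_zero
      (f := fun p => (C p).2.1) (by fun_prop) (himm h1))
    refine this.mono fun r hr he => ⟨k, ?_⟩
    have h3 := (hp2 r.1).sub_int_mul_eq (x := r.2.2) k
    simp only [mul_one] at h3
    have := hr (by rw [h3, he])
    linarith
  · have := htend.eventually (eventually_injective_of_deriv_ne_zero
      (f := fun p => (C p).1) (by fun_prop) h1)
    refine this.mono fun r hr he => ⟨k, ?_⟩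
    have h3 := (hp1 r.1).sub_int_mul_eq (x := r.2.2) k
    simp only [mul_one] at h3
    have := hr (by rw [h3, he])
    linarith

end LocalInjectivity

section Transversality

theorem exists_small_of_transverse {E P V : Type} [NormedAddCommGroup E] [NormedSpace ℝ E]
    [FiniteDimensional ℝ E] [NormedAddCommGroup P] [NormedSpace ℝ P] [FiniteDimensional ℝ P]
    [Nontrivial P] [NormedAddCommGroup V] [NormedSpace ℝ V] [FiniteDimensional ℝ V]
    (hdim : Module.finrank ℝ E < Module.finrank ℝ V) {F : E × P → V} (hF : ContDiff ℝ ∞ F)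
    {K D : Set E} (hK : IsCompact K)
    (h : ∀ k ∈ K, (∀ᶠ q in 𝓝 (k, (0 : P)), F q = 0 → q.1 ∈ D) ∨
      (F (k, 0) = 0 ∧ (fderiv ℝ F (k, 0)).range = ⊤))
    {W : Set P} (hW : W ∈ 𝓝 0) : ∃ p ∈ W, ∀ k ∈ K, F (k, p) = 0 → k ∈ D := by
  have h0 : (0 : ENNReal) < Module.finrank ℝ P := by
    exact_mod_cast Module.finrank_pos
  have key : ∃ U ∈ 𝓝 (0 : P), ∃ B : Set P, dimH B < Module.finrank ℝ P ∧
      ∀ k ∈ K, ∀ p ∈ U, p ∉ B → F (k, p) = 0 → k ∈ D := by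
    refine hK.induction_on (p := fun S => ∃ U ∈ 𝓝 (0 : P), ∃ B : Set P,
      dimH B < Module.finrank ℝ P ∧ ∀ k ∈ S, ∀ p ∈ U, p ∉ B → F (k, p) = 0 → k ∈ D) ?_ ?_ ?_ ?_
    · exact ⟨univ, univ_mem, ∅, by simpa using h0, by simp⟩
    · rintro S T hST ⟨U, hU, B, hB, hT⟩
      exact ⟨U, hU, B, hB, fun k hk => hT k (hST hk)⟩
    · rintro S T ⟨U, hU, B, hB, hS⟩ ⟨U', hU', B', hB', hT⟩
      refine ⟨U ∩ U', inter_mem hU hU', B ∪ B', by rw [dimH_union]; exact max_lt hB hB', ?_⟩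
      rintro k (hk | hk) p hp hpB
      · exact hS k hk p hp.1 fun h => hpB (Or.inl h)
      · exact hT k hk p hp.2 fun h => hpB (Or.inr h)
    · intro k hk
      rcases h k hk with h | ⟨h1, h2⟩
      · rw [nhds_prod_eq] at h
        obtain ⟨A, hA, U, hU, hAU⟩ := mem_prod_iff.1 h
        exact ⟨A, mem_nhdsWithin_of_mem_nhds hA, U, hU, ∅, by simpa using h0,
          fun k hk p hp _ => hAU (mk_mem_prod hk hp)⟩
      · obtain ⟨N, hN, hdimN⟩ := exists_nhds_dimH_image_snd_lt hdim hF h1 h2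
        rw [nhds_prod_eq] at hN
        obtain ⟨A, hA, U, hU, hAU⟩ := mem_prod_iff.1 hN
        exact ⟨A, mem_nhdsWithin_of_mem_nhds hA, U, hU, _, hdimN,
          fun k hk p hp hpB hz => absurd ⟨(k, p), ⟨hAU (mk_mem_prod hk hp), hz⟩, rfl⟩ hpB⟩
  obtain ⟨U, hU, B, hB, hUB⟩ := key
  obtain ⟨p, hpB, hpW⟩ := (dense_compl_of_dimH_lt_finrank hB).inter_nhds_nonempty
    (inter_mem hU hW)
  exact ⟨p, hpW.2, fun k hk => hUB k hk p hpW.1 hpB⟩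

end Transversality

section Perturbation

/-- The pairing of a covector with the variation at two parameters of the curve
`(correct x g, moments)`. -/
noncomputable def pairing (x g : ℝ → ℝ) (ξ : ℝ × ℝ × ℝ) (a b : ℝ) : ℝ :=
  ξ.1 * (correct x g b - correct x g a) +
    ξ.2.1 * (moment x (correct x g) 0 b - moment x (correct x g) 0 a) +
    ξ.2.2 * (moment x (correct x g) 1 b - moment x (correct x g) 1 a)

/-- The space of parameters `(t, a, b)` with `t` a time and `a ≤ b ≤ a + 1` two points of the
loop. -/
def pairSpace : Set (ℝ × ℝ × ℝ) :=
  {k | k.1 ∈ Icc (0:ℝ) 1 ∧ k.2.1 ∈ Icc (0:ℝ) 1 ∧ k.2.2 ∈ Icc k.2.1 (k.2.1 + 1)}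

theorem isCompact_pairSpace : IsCompact pairSpace := by
  have h : IsCompact (Icc (0:ℝ) 1 ×ˢ (Icc (0:ℝ) 1 ×ˢ Icc (0:ℝ) 2)) :=
    isCompact_Icc.prod (isCompact_Icc.prod isCompact_Icc)
  refine h.of_isClosed_subset ?_ ?_
  · simp only [pairSpace, mem_Icc, ofPred_and]
    refine IsClosed.inter (IsClosed.inter ?_ ?_) (IsClosed.inter (IsClosed.inter ?_ ?_)
      (IsClosed.inter ?_ ?_))
    all_goals exact isClosed_le (by fun_prop) (by fun_prop)
  · rintro ⟨t, a, b⟩ ⟨ht, ha, hb⟩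
    exact ⟨ht, ha, by linarith [hb.1, ha.1], by linarith [hb.2, ha.2]⟩

theorem exists_deriv_ne_zero_of_eq {x y : ℝ → ℝ} (hy : Continuous y)
    (himm : ∀ s, deriv x s = 0 → deriv y s ≠ 0) {a b : ℝ} (hab : a < b) (h : y a = y b) :
    ∃ c ∈ Ioo a b, deriv x c ≠ 0 := by
  obtain ⟨c, hc, hc'⟩ := exists_deriv_eq_zero hab hy.continuousOn h
  exact ⟨c, hc, fun h => himm c h hc'⟩

theorem exists_pairing_ne_zero {x y : ℝ → ℝ} (hx : ContDiff ℝ ∞ x) (hxp : Function.Periodic x 1)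
    (hy : Continuous y) (hyp : Function.Periodic y 1)
    (himm : ∀ s, deriv x s = 0 → deriv y s ≠ 0) {a b : ℝ} (hab : a < b) (hba : b < a + 1)
    (h : y b = y a) {ξ : ℝ × ℝ × ℝ} (hξ : ξ ≠ 0) :
    ∃ g : ℝ → ℝ, ContDiff ℝ ∞ g ∧ Function.Periodic g 1 ∧ pairing x g ξ a b ≠ 0 := by
  obtain ⟨c, hc, hxc⟩ := exists_deriv_ne_zero_of_eq hy himm hab h.symm
  obtain ⟨d, hd, hxd⟩ := exists_deriv_ne_zero_of_eq hy himm hba (by rw [hyp, h])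
  refine exists_correct_pairing_ne_zero hx hxp hab hba hc hxc hd hxd fun h => hξ ?_
  exact Prod.ext h.1 (Prod.ext h.2.1 h.2.2)

theorem mem_Ioo_of_forall_sub_ne_int {a b : ℝ} (h : b ∈ Icc a (a + 1)) (h' : ¬∃ k : ℤ, b - a = k) :
    b ∈ Ioo a (a + 1) := by
  refine ⟨lt_of_le_of_ne h.1 fun e => h' ⟨0, by simp [e]⟩,
    lt_of_le_of_ne h.2 fun e => h' ⟨1, by simp [e]⟩⟩

variable {X G : ℝ × ℝ → ℝ}

theorem continuous_pairing (hX : ContDiff ℝ ∞ X) {g : ℝ → ℝ} (hg : ContDiff ℝ ∞ g) :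
    Continuous fun r : (ℝ × ℝ × ℝ) × (ℝ × ℝ × ℝ) =>
      pairing (fun s => X (r.1.1, s)) g r.2 r.1.2.1 r.1.2.2 := by
  have hcor : ContDiff ℝ ∞ fun p : ℝ × ℝ => correct (fun s => X (p.1, s)) g p.2 :=
    contDiff_correct_family (Q := ℝ) hX (Y := fun p => g p.2) (by fun_prop)
  have hm : ∀ i, Continuous fun p : ℝ × ℝ =>
      moment (fun s => X (p.1, s)) (correct (fun s => X (p.1, s)) g) i p.2 := fun i =>
    (contDiff_moment hX hcor i).continuous
  have h : ∀ f : ℝ × ℝ → ℝ, Continuous f → Continuous fun r : (ℝ × ℝ × ℝ) × (ℝ × ℝ × ℝ) =>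
      f (r.1.1, r.1.2.2) - f (r.1.1, r.1.2.1) := fun f hf => by fun_prop
  have hc := h _ hcor.continuous
  have h0 := h _ (hm 0)
  have h1 := h _ (hm 1)
  simp only [] at hc h0 h1
  unfold pairing
  exact (((continuous_fst.comp continuous_snd).mul hc).add
    ((continuous_fst.comp (continuous_snd.comp continuous_snd)).mul h0)).add
    ((continuous_snd.comp (continuous_snd.comp continuous_snd)).mul h1)

/-- Finitely many deformations of `y` suffice to move all double points of a family of loops. -/
theorem exists_finite_pairing_ne_zero {C : ℝ × ℝ → ℝ × ℝ × ℝ × ℝ} (hC : ContDiff ℝ ∞ C)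
    (hXp : ∀ t, Function.Periodic (fun s => (C (t, s)).1) 1)
    (hYp : ∀ t, Function.Periodic (fun s => (C (t, s)).2.1) 1)
    (himm : ∀ t s, deriv (fun s => (C (t, s)).1) s = 0 → deriv (fun s => (C (t, s)).2.1) s ≠ 0) :
    ∃ S : Set (ℝ → ℝ), S.Finite ∧ (∀ g ∈ S, ContDiff ℝ ∞ g ∧ Function.Periodic g 1) ∧
      ∀ k ∈ pairSpace, (¬∃ m : ℤ, k.2.2 - k.2.1 = m) → C (k.1, k.2.2) = C (k.1, k.2.1) →
        ∀ ξ : ℝ × ℝ × ℝ, ξ ≠ 0 →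
          ∃ g ∈ S, pairing (fun s => (C (k.1, s)).1) g ξ k.2.1 k.2.2 ≠ 0 := by
  have hX : ContDiff ℝ ∞ fun p => (C p).1 := hC.fst
  have hXt : ∀ t, ContDiff ℝ ∞ fun s => (C (t, s)).1 := fun t => by fun_prop
  have hYt : ∀ t, Continuous fun s => (C (t, s)).2.1 := fun t => by
    have := hC.continuous
    fun_prop
  have hcomp : IsCompact (pairSpace ×ˢ Metric.sphere (0 : ℝ × ℝ × ℝ) 1) :=
    isCompact_pairSpace.prod (isCompact_sphere _ _)
  suffices h : ∃ S : Set (ℝ → ℝ), S.Finite ∧ (∀ g ∈ S, ContDiff ℝ ∞ g ∧ Function.Periodic g 1) ∧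
      ∀ r ∈ pairSpace ×ˢ Metric.sphere (0 : ℝ × ℝ × ℝ) 1, (¬∃ m : ℤ, r.1.2.2 - r.1.2.1 = m) →
        C (r.1.1, r.1.2.2) = C (r.1.1, r.1.2.1) →
        ∃ g ∈ S, pairing (fun s => (C (r.1.1, s)).1) g r.2 r.1.2.1 r.1.2.2 ≠ 0 by
    obtain ⟨S, hS, hSg, h⟩ := h
    refine ⟨S, hS, hSg, fun k hk hm he ξ hξ => ?_⟩
    have hn : ‖ξ‖ ≠ 0 := norm_ne_zero_iff.2 hξ
    obtain ⟨g, hg, hgn⟩ := h (k, ‖ξ‖⁻¹ • ξ) ⟨hk, by simp [norm_smul, hn]⟩ hm he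
    refine ⟨g, hg, fun h0 => hgn ?_⟩
    have : pairing (fun s => (C (k.1, s)).1) g (‖ξ‖⁻¹ • ξ) k.2.1 k.2.2 =
        ‖ξ‖⁻¹ * pairing (fun s => (C (k.1, s)).1) g ξ k.2.1 k.2.2 := by
      simp only [pairing, Prod.smul_fst, Prod.smul_snd, smul_eq_mul]; ring
    simp only [this, h0, mul_zero]
  refine hcomp.induction_on (p := fun R => ∃ S : Set (ℝ → ℝ), S.Finite ∧
    (∀ g ∈ S, ContDiff ℝ ∞ g ∧ Function.Periodic g 1) ∧
      ∀ r ∈ R, (¬∃ m : ℤ, r.1.2.2 - r.1.2.1 = m) → C (r.1.1, r.1.2.2) = C (r.1.1, r.1.2.1) →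
        ∃ g ∈ S, pairing (fun s => (C (r.1.1, s)).1) g r.2 r.1.2.1 r.1.2.2 ≠ 0) ?_ ?_ ?_ ?_
  · exact ⟨∅, finite_empty, by simp, by simp⟩
  · rintro R T hRT ⟨S, hS, hSg, h⟩
    exact ⟨S, hS, hSg, fun r hr => h r (hRT hr)⟩
  · rintro R T ⟨S, hS, hSg, h⟩ ⟨S', hS', hSg', h'⟩
    refine ⟨S ∪ S', hS.union hS', fun g hg => hg.elim (hSg g) (hSg' g), ?_⟩
    rintro r (hr | hr) hm he
    · obtain ⟨g, hg, hn⟩ := h r hr hm he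
      exact ⟨g, Or.inl hg, hn⟩
    · obtain ⟨g, hg, hn⟩ := h' r hr hm he
      exact ⟨g, Or.inr hg, hn⟩
  · rintro ⟨⟨t, a, b⟩, ξ⟩ ⟨⟨ht, ha, hb⟩, hξ⟩
    by_cases hinj : C (t, b) = C (t, a) → ∃ k : ℤ, b - a = k
    · have := eventually_int_sub_of_eq hC (q := t) (a := a) (b := b) hXp hYp (himm t a) hinj
      have h2 := (continuous_fst.tendsto ((t, a, b), ξ)).eventually this
      exact ⟨_, mem_nhdsWithin_of_mem_nhds h2, ∅, finite_empty, by simp,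
        fun r hr hm he => absurd (hr he) hm⟩
    · push Not at hinj
      obtain ⟨hab, hba⟩ := mem_Ioo_of_forall_sub_ne_int hb (by push Not; exact hinj.2)
      have hξ0 : ξ ≠ 0 := fun h => by simp [h] at hξ
      obtain ⟨g, hg, hgp, hn⟩ := exists_pairing_ne_zero (hXt t) (hXp t) (hYt t) (hYp t)
        (himm t) hab hba (congrArg (fun v => v.2.1) hinj.1) hξ0
      exact ⟨_, mem_nhdsWithin_of_mem_nhds ((continuous_pairing (X := fun p => (C p).1) hX hg).continuousAt.eventually_ne hn), {g},
        finite_singleton g, by rintro _ rfl; exact ⟨hg, hgp⟩, fun r hr _ _ => ⟨g, rfl, hr⟩⟩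

end Perturbation

section GeneralPosition

variable {ι : Type} {X G : ℝ × ℝ → ℝ}

/-- The family `X` deformed, relative to the times `0` and `1`, by the first harmonics. -/
noncomputable def deformX (X : ℝ × ℝ → ℝ) (r : (ℝ × ℝ × ℝ × (ι → ℝ)) × ℝ) : ℝ :=
  X (r.1.1, r.2) + r.1.1 * (1 - r.1.1) *
    (r.1.2.1 * Real.cos (2 * Real.pi * r.2) + r.1.2.2.1 * Real.sin (2 * Real.pi * r.2))

theorem periodic_deformX (hX : ∀ t, Function.Periodic (fun s => X (t, s)) 1)
    (q : ℝ × ℝ × ℝ × (ι → ℝ)) : Function.Periodic (fun s => deformX X (q, s)) 1 := fun s => by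
  have := hX q.1 s
  simp only at this
  simp only [deformX, this, mul_add, mul_one, Real.cos_add_two_pi, Real.sin_add_two_pi]

theorem deformX_of_eq_zero {q : ℝ × ℝ × ℝ × (ι → ℝ)} (h : q.1 * (1 - q.1) = 0) (s : ℝ) :
    deformX X (q, s) = X (q.1, s) := by
  simp [deformX, h]

theorem deformX_zero (t s : ℝ) : deformX (ι := ι) X ((t, 0), s) = X (t, s) := by
  simp [deformX]

variable [Fintype ι]

/-- The family `G` deformed, relative to the times `0` and `1`, by the functions `g j`. -/
noncomputable def deformG (G : ℝ × ℝ → ℝ) (g : ι → ℝ → ℝ)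
    (r : (ℝ × ℝ × ℝ × (ι → ℝ)) × ℝ) : ℝ :=
  G (r.1.1, r.2) + r.1.1 * (1 - r.1.1) * ∑ j, r.1.2.2.2 j * g j r.2

/-- The moment curves of the deformed family. -/
noncomputable def deformCurve (X G : ℝ × ℝ → ℝ) (g : ι → ℝ → ℝ)
    (r : (ℝ × ℝ × ℝ × (ι → ℝ)) × ℝ) : ℝ × ℝ × ℝ × ℝ :=
  momentCurve (fun s => deformX X (r.1, s))
    (correct (fun s => deformX X (r.1, s)) (fun s => deformG G g (r.1, s))) r.2

/-- The difference of the values of the deformed moment curve at two parameters. -/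
noncomputable def deformDiff (X G : ℝ × ℝ → ℝ) (g : ι → ℝ → ℝ)
    (r : (ℝ × ℝ × ℝ) × (ℝ × ℝ × (ι → ℝ))) : ℝ × ℝ × ℝ × ℝ :=
  deformCurve X G g ((r.1.1, r.2), r.1.2.2) - deformCurve X G g ((r.1.1, r.2), r.1.2.1)

variable {g : ι → ℝ → ℝ}

theorem contDiff_deformX (hX : ContDiff ℝ ∞ X) : ContDiff ℝ ∞ (deformX (ι := ι) X) := by
  unfold deformX
  fun_prop

theorem contDiff_deformG (hG : ContDiff ℝ ∞ G) (hg : ∀ j, ContDiff ℝ ∞ (g j)) :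
    ContDiff ℝ ∞ (deformG G g) := by
  unfold deformG
  fun_prop

theorem contDiff_deformCurve (hX : ContDiff ℝ ∞ X) (hG : ContDiff ℝ ∞ G)
    (hg : ∀ j, ContDiff ℝ ∞ (g j)) : ContDiff ℝ ∞ (deformCurve X G g) :=
  contDiff_momentCurve (contDiff_deformX hX)
    (contDiff_correct_family (contDiff_deformX hX) (contDiff_deformG hG hg))

theorem contDiff_deformDiff (hX : ContDiff ℝ ∞ X) (hG : ContDiff ℝ ∞ G)
    (hg : ∀ j, ContDiff ℝ ∞ (g j)) : ContDiff ℝ ∞ (deformDiff X G g) := by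
  have := contDiff_deformCurve hX hG hg
  unfold deformDiff
  fun_prop

theorem periodic_deformG (hG : ∀ t, Function.Periodic (fun s => G (t, s)) 1)
    (hg : ∀ j, Function.Periodic (g j) 1) (q : ℝ × ℝ × ℝ × (ι → ℝ)) :
    Function.Periodic (fun s => deformG G g (q, s)) 1 := fun s => by
  have := hG q.1 s
  simp only at this
  simp only [deformG, this, fun j => hg j s]

theorem deformG_of_eq_zero {q : ℝ × ℝ × ℝ × (ι → ℝ)} (h : q.1 * (1 - q.1) = 0) (s : ℝ) :
    deformG G g (q, s) = G (q.1, s) := by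
  simp [deformG, h]

theorem deformG_zero (t s : ℝ) : deformG G g ((t, 0), s) = G (t, s) := by
  simp [deformG]

theorem deformCurve_zero (t s : ℝ) :
    deformCurve X G g ((t, 0), s) = momentCurve (fun s => X (t, s))
      (correct (fun s => X (t, s)) (fun s => G (t, s))) s := by
  simp only [deformCurve, deformX_zero, deformG_zero]

theorem deformCurve_single [DecidableEq ι] (hX : ContDiff ℝ ∞ X) (hG : ContDiff ℝ ∞ G)
    (hg : ∀ j, ContDiff ℝ ∞ (g j)) (t τ s : ℝ) (j : ι) :
    deformCurve X G g ((t, τ • ((0 : ℝ), (0 : ℝ), Pi.single j (1 : ℝ))), s) =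
      deformCurve X G g ((t, 0), s) + (τ * (t * (1 - t))) •
        (0, correct (fun s => X (t, s)) (g j) s,
          moment (fun s => X (t, s)) (correct (fun s => X (t, s)) (g j)) 0 s,
          moment (fun s => X (t, s)) (correct (fun s => X (t, s)) (g j)) 1 s) := by
  have hXt : ContDiff ℝ ∞ fun s => X (t, s) := by fun_prop
  have hGt : ContDiff ℝ ∞ fun s => G (t, s) := by fun_prop
  have e1 : ∀ s, deformX X ((t, τ • ((0 : ℝ), (0 : ℝ), Pi.single j (1 : ℝ))), s) = X (t, s) := by
    intro s; simp [deformX]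
  have e2 : ∀ s, deformG G g ((t, τ • ((0 : ℝ), (0 : ℝ), Pi.single j (1 : ℝ))), s) =
      G (t, s) + (τ * (t * (1 - t))) * g j s := by
    intro s
    simp [deformG, Pi.single_apply]
    ring
  have e3 : correct (fun s => X (t, s)) (fun s => G (t, s) + (τ * (t * (1 - t))) * g j s) =
      fun s => correct (fun s => X (t, s)) (fun s => G (t, s)) s +
        (τ * (t * (1 - t))) * correct (fun s => X (t, s)) (g j) s := by
    ext s
    exact correct_add_smul hXt hGt.continuous (hg j).continuous _ s
  have hc1 := (contDiff_correct hXt hGt).continuous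
  have hc2 := (contDiff_correct hXt (hg j)).continuous
  rw [deformCurve_zero]
  simp only [deformCurve, e1, e2, e3, momentCurve, moment_add_smul hXt hc1 hc2]
  simp

theorem deformCurve_fst (t l₁ l₂ s : ℝ) :
    (deformCurve X G g ((t, l₁, l₂, 0), s)).1 = X (t, s) + t * (1 - t) *
      (l₁ * Real.cos (2 * Real.pi * s) + l₂ * Real.sin (2 * Real.pi * s)) := rfl

theorem map_fderiv_apply_of_affine {E P V : Type} [NormedAddCommGroup E] [NormedSpace ℝ E]
    [NormedAddCommGroup P] [NormedSpace ℝ P] [NormedAddCommGroup V] [NormedSpace ℝ V]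
    {F : E × P → V} {k : E} (hF : DifferentiableAt ℝ F (k, 0)) (f : V →L[ℝ] ℝ) (v : P) (c : ℝ)
    (h : ∀ τ : ℝ, f (F (k, τ • v)) = f (F (k, 0)) + τ * c) : f (fderiv ℝ F (k, 0) (0, v)) = c := by
  have h1 : HasDerivAt (fun τ : ℝ => (k, τ • v)) (0, v) 0 := by
    simpa using (hasDerivAt_const (0 : ℝ) k).prodMk ((hasDerivAt_id (0 : ℝ)).smul_const v)
  have h2 : HasFDerivAt F (fderiv ℝ F (k, 0)) ((fun τ : ℝ => (k, τ • v)) 0) := by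
    simpa using hF.hasFDerivAt
  have h3 := f.hasFDerivAt.comp_hasDerivAt (0 : ℝ) (h2.comp_hasDerivAt (0 : ℝ) h1)
  have h4 : HasDerivAt (fun τ : ℝ => f (F (k, 0)) + τ * c) c 0 := by
    simpa using ((hasDerivAt_id (0 : ℝ)).mul_const c).const_add (f (F (k, 0)))
  refine h3.unique (h4.congr_of_eventuallyEq (Eventually.of_forall fun τ => h τ))

theorem range_fderiv_deformDiff (hX : ContDiff ℝ ∞ X) (hG : ContDiff ℝ ∞ G)
    (hg : ∀ j, ContDiff ℝ ∞ (g j)) {k : ℝ × ℝ × ℝ} (ht : k.1 * (1 - k.1) ≠ 0)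
    (hk : ¬∃ m : ℤ, k.2.2 - k.2.1 = m)
    (hspan : ∀ ξ : ℝ × ℝ × ℝ, ξ ≠ 0 → ∃ j, pairing (fun s => X (k.1, s)) (g j) ξ k.2.1 k.2.2 ≠ 0) :
    (fderiv ℝ (deformDiff X G g) (k, 0)).range = ⊤ := by
  classical
  by_contra hne
  obtain ⟨f, hf0, hf⟩ := Submodule.exists_le_ker_of_lt_top _ (lt_top_iff_ne_top.2 hne)
  have hD : DifferentiableAt ℝ (deformDiff X G g) (k, 0) :=
    (contDiff_deformDiff hX hG hg).differentiable (by simp) _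
  set φ : ℝ × ℝ × ℝ × ℝ →L[ℝ] ℝ := LinearMap.toContinuousLinearMap f with hφ
  have hzero : ∀ v, φ (fderiv ℝ (deformDiff X G g) (k, 0) v) = 0 := fun v =>
    hf (LinearMap.mem_range_self _ v)
  have hexp : ∀ u : ℝ × ℝ × ℝ × ℝ, φ u = u.1 * φ (1, 0, 0, 0) + u.2.1 * φ (0, 1, 0, 0) +
      u.2.2.1 * φ (0, 0, 1, 0) + u.2.2.2 * φ (0, 0, 0, 1) := by
    intro u
    simp only [← smul_eq_mul, ← map_smul, ← map_add]
    congr 1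
    simp
  set ξ : ℝ × ℝ × ℝ := (φ (0, 1, 0, 0), φ (0, 0, 1, 0), φ (0, 0, 0, 1)) with hξdef
  by_cases hξ : ξ = 0
  · have h1 : φ (0, 1, 0, 0) = 0 := congrArg (fun v => v.1) hξ
    have h2 : φ (0, 0, 1, 0) = 0 := congrArg (fun v => v.2.1) hξ
    have h3 : φ (0, 0, 0, 1) = 0 := congrArg (fun v => v.2.2) hξ
    have h4 : φ (1, 0, 0, 0) ≠ 0 := by
      intro h4
      refine hf0 (LinearMap.ext fun u => ?_)
      have := hexp u
      rw [h1, h2, h3, h4] at this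
      exact show φ u = 0 by simpa using this
    have hlam : ∀ l₁ l₂ : ℝ, l₁ * (Real.cos (2 * Real.pi * k.2.2) - Real.cos (2 * Real.pi * k.2.1)) +
        l₂ * (Real.sin (2 * Real.pi * k.2.2) - Real.sin (2 * Real.pi * k.2.1)) = 0 := by
      intro l₁ l₂
      have := map_fderiv_apply_of_affine hD φ (l₁, l₂, (0 : ι → ℝ)) (φ (1, 0, 0, 0) *
        (k.1 * (1 - k.1)) * (l₁ * (Real.cos (2 * Real.pi * k.2.2) - Real.cos (2 * Real.pi * k.2.1)) +
        l₂ * (Real.sin (2 * Real.pi * k.2.2) - Real.sin (2 * Real.pi * k.2.1)))) ?_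
      · rw [hzero] at this
        simpa [h4, ht] using this.symm
      · intro τ
        rw [hexp, hexp (deformDiff X G g (k, 0)), h1, h2, h3]
        have e0 : (0 : ℝ × ℝ × (ι → ℝ)) = (0, 0, 0) := rfl
        simp only [deformDiff, Prod.fst_sub, Prod.smul_mk, smul_zero, e0, deformCurve_fst,
          smul_eq_mul]
        ring
    refine hk (exists_int_of_trig_eq ?_ ?_)
    · have := hlam 1 0; linarith
    · have := hlam 0 1; linarith
  · obtain ⟨j, hj⟩ := hspan ξ hξ
    have := map_fderiv_apply_of_affine hD φ ((0 : ℝ), (0 : ℝ), Pi.single j (1 : ℝ))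
      (k.1 * (1 - k.1) * pairing (fun s => X (k.1, s)) (g j) ξ k.2.1 k.2.2) ?_
    · rw [hzero] at this
      exact mul_ne_zero ht hj this.symm
    · intro τ
      rw [hexp, hexp (deformDiff X G g (k, 0))]
      simp only [deformDiff, deformCurve_single hX hG hg, pairing, hξdef, Prod.fst_sub,
        Prod.snd_sub, Prod.fst_add, Prod.snd_add, Prod.smul_fst, Prod.smul_snd, smul_eq_mul]
      ring

/-- A family of immersed plane loops whose moment curves are embedded at times `0` and `1` can be
deformed, relative to these times, so that the moment curves become embedded at all times. -/
theorem exists_embedded_family (hX : ContDiff ℝ ∞ X) (hG : ContDiff ℝ ∞ G)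
    (hXp : ∀ t, Function.Periodic (fun s => X (t, s)) 1)
    (hGp : ∀ t, Function.Periodic (fun s => G (t, s)) 1)
    (himm : ∀ t s, deriv (fun s => X (t, s)) s = 0 →
      deriv (correct (fun s => X (t, s)) (fun s => G (t, s))) s ≠ 0)
    (hinj : ∀ t, t * (1 - t) = 0 → ∀ a b,
      momentCurve (fun s => X (t, s)) (correct (fun s => X (t, s)) (fun s => G (t, s))) b =
      momentCurve (fun s => X (t, s)) (correct (fun s => X (t, s)) (fun s => G (t, s))) a →
      ∃ m : ℤ, b - a = m) :
    ∃ X' Y' : ℝ × ℝ → ℝ, ContDiff ℝ ∞ X' ∧ ContDiff ℝ ∞ Y' ∧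
      (∀ t, Function.Periodic (fun s => X' (t, s)) 1) ∧
      (∀ t, Function.Periodic (fun s => Y' (t, s)) 1) ∧
      (∀ t i, i < 2 → moment (fun s => X' (t, s)) (fun s => Y' (t, s)) i 1 = 0) ∧
      (∀ t ∈ Icc (0:ℝ) 1, ∀ s, deriv (fun s => X' (t, s)) s = 0 →
        deriv (fun s => Y' (t, s)) s ≠ 0) ∧
      (∀ t ∈ Icc (0:ℝ) 1, ∀ a b,
        momentCurve (fun s => X' (t, s)) (fun s => Y' (t, s)) b =
        momentCurve (fun s => X' (t, s)) (fun s => Y' (t, s)) a → ∃ m : ℤ, b - a = m) ∧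
      ∀ t, t * (1 - t) = 0 → ∀ s, X' (t, s) = X (t, s) ∧
        Y' (t, s) = correct (fun s => X (t, s)) (fun s => G (t, s)) s := by
  have hC : ContDiff ℝ ∞ fun p : ℝ × ℝ => momentCurve (fun s => X (p.1, s))
      (correct (fun s => X (p.1, s)) (fun s => G (p.1, s))) p.2 :=
    contDiff_momentCurve hX (contDiff_correct_family hX hG)
  have hYp : ∀ t, Function.Periodic (correct (fun s => X (t, s)) (fun s => G (t, s))) 1 :=
    fun t => periodic_correct (hXp t) (hGp t)
  obtain ⟨S, hS, hSg, hspan⟩ := exists_finite_pairing_ne_zero hC hXp hYp himm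
  have := hS.fintype
  set g : S → ℝ → ℝ := Subtype.val with hgdef
  have hg : ∀ j, ContDiff ℝ ∞ (g j) := fun j => (hSg j j.2).1
  have hgp : ∀ j, Function.Periodic (g j) 1 := fun j => (hSg j j.2).2
  have hdX := contDiff_deformX (ι := S) hX
  have hdG := contDiff_deformG hG hg
  have hdC := contDiff_deformCurve hX hG hg
  have hdXp := periodic_deformX (ι := S) hXp
  have hdYp := fun q => periodic_correct (hdXp q) (periodic_deformG hGp hgp q)
  have hdY := contDiff_correct_family hdX hdG
  have hdX' := contDiff_deriv_snd hdX
  have hdY' := contDiff_deriv_snd hdY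
  have hsmall : ∀ᶠ p : ℝ × ℝ × (S → ℝ) in 𝓝 0, ∀ r ∈ Icc (0:ℝ) 1 ×ˢ Icc (0:ℝ) 1,
      deriv (fun s => deformX X ((r.1, p), s)) r.2 = 0 →
      deriv (correct (fun s => deformX X ((r.1, p), s)) (fun s => deformG G g ((r.1, p), s))) r.2
        ≠ 0 := by
    refine IsCompact.eventually_forall_of_forall_eventually (isCompact_Icc.prod isCompact_Icc)
      fun r _ => ?_
    have htend : Continuous fun z : (ℝ × ℝ × (S → ℝ)) × (ℝ × ℝ) => ((z.2.1, z.1), z.2.2) := by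
      fun_prop
    by_cases h : deriv (fun s => X (r.1, s)) r.2 = 0
    · have h1 := himm r.1 r.2 h
      refine (((hdY'.continuous.comp htend).continuousAt (x := (0, r))).eventually_ne
        (y := 0) ?_).mono fun z hz _ => hz
      simp only [Function.comp, deformX_zero, deformG_zero]
      exact h1
    · refine (((hdX'.continuous.comp htend).continuousAt (x := (0, r))).eventually_ne
        (y := 0) ?_).mono fun z hz hz' => absurd hz' hz
      simp only [Function.comp, deformX_zero]
      exact h
  have htrans : ∀ k ∈ pairSpace, (∀ᶠ q in 𝓝 (k, (0 : ℝ × ℝ × (S → ℝ))),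
      deformDiff X G g q = 0 → q.1 ∈ {k : ℝ × ℝ × ℝ | ∃ m : ℤ, k.2.2 - k.2.1 = m}) ∨
      (deformDiff X G g (k, 0) = 0 ∧ (fderiv ℝ (deformDiff X G g) (k, 0)).range = ⊤) := by
    intro k hk
    by_cases h : deformCurve X G g ((k.1, 0), k.2.2) = deformCurve X G g ((k.1, 0), k.2.1) →
        ∃ m : ℤ, k.2.2 - k.2.1 = m
    · left
      have himm0 : deriv (fun s => (deformCurve X G g ((k.1, 0), s)).1) k.2.1 = 0 →
          deriv (fun s => (deformCurve X G g ((k.1, 0), s)).2.1) k.2.1 ≠ 0 := by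
        simp only [deformCurve_zero]
        exact himm k.1 k.2.1
      have htend : Continuous fun z : (ℝ × ℝ × ℝ) × (ℝ × ℝ × (S → ℝ)) =>
          ((z.1.1, z.2), z.1.2.1, z.1.2.2) := by fun_prop
      have := (htend.tendsto (k, 0)).eventually
        (eventually_int_sub_of_eq hdC hdXp hdYp himm0 h)
      exact this.mono fun z hz hz' => hz (sub_eq_zero.1 hz')
    · right
      push Not at h
      have hm : ¬∃ m : ℤ, k.2.2 - k.2.1 = m := by push Not; exact h.2
      have he := h.1
      simp only [deformCurve_zero] at he
      refine ⟨sub_eq_zero.2 h.1, range_fderiv_deformDiff hX hG hg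
        (fun ht => hm (hinj k.1 ht _ _ he)) hm fun ξ hξ => ?_⟩
      obtain ⟨f, hf, hfn⟩ := hspan k hk hm he ξ hξ
      exact ⟨⟨f, hf⟩, hfn⟩
  obtain ⟨p, hp, hpinj⟩ := exists_small_of_transverse (F := deformDiff X G g)
    (D := {k | ∃ m : ℤ, k.2.2 - k.2.1 = m}) (by simp) (contDiff_deformDiff hX hG hg)
    isCompact_pairSpace htrans hsmall
  have hXt : ∀ q, ContDiff ℝ ∞ fun s => deformX (ι := S) X (q, s) := fun q => by fun_prop
  have hGt : ∀ q, ContDiff ℝ ∞ fun s => deformG G g (q, s) := fun q => by fun_prop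
  have hfract : ∀ {V : Type} {f : ℝ → V}, Function.Periodic f 1 → ∀ (m : ℤ) s, f (s - m) = f s :=
    fun hf m s => by simpa using hf.sub_int_mul_eq (x := s) m
  have hfract_mem : ∀ s : ℝ, s - ⌊s⌋ ∈ Icc (0:ℝ) 1 := fun s =>
    ⟨Int.fract_nonneg s, (Int.fract_lt_one s).le⟩
  have hM : ∀ t i, i < 2 → moment (fun s => deformX X ((t, p), s))
      (correct (fun s => deformX X ((t, p), s)) (fun s => deformG G g ((t, p), s))) i 1 = 0 := by
    intro t i hi
    interval_cases i
    · exact moment_correct_zero (hXt _) (hGt _).continuous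
    · exact moment_correct_one (hXt _) (hGt _).continuous
  refine ⟨fun r => deformX X ((r.1, p), r.2), fun r => correct (fun s => deformX X ((r.1, p), s))
    (fun s => deformG G g ((r.1, p), s)) r.2, by fun_prop, ?_, fun t => hdXp (t, p),
    fun t => hdYp (t, p), hM, ?_, ?_, ?_⟩
  · have h : ContDiff ℝ ∞ fun r : ℝ × ℝ => ((r.1, p), r.2) := by fun_prop
    have h' := hdY.comp h
    simp only [Function.comp_def] at h'
    exact h'
  · intro t ht s hs
    have h1 := hp (t, s - ⌊s⌋) ⟨ht, hfract_mem s⟩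
    simp only [hfract (hdXp (t, p)).deriv_one, hfract (hdYp (t, p)).deriv_one] at h1
    exact h1 hs
  · intro t ht a b hab
    have hper := periodic_momentCurve (hXt (t, p)) (hdXp (t, p))
      (contDiff_correct (hXt (t, p)) (hGt (t, p))).continuous (hdYp (t, p))
      (hM t 0 (by simp)) (hM t 1 (by simp))
    have hu := hfract_mem (b - (a - ⌊a⌋))
    obtain ⟨m, hm⟩ := hpinj (t, a - ⌊a⌋, b - ⌊b - (a - ⌊a⌋)⌋)
      ⟨ht, hfract_mem a, by simp only; linarith [hu.1], by simp only; linarith [hu.2]⟩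
      (sub_eq_zero.2 (by
        simp only [deformCurve, hfract hper]
        exact hab))
    simp only at hm
    refine ⟨m + ⌊b - (a - ⌊a⌋)⌋ - ⌊a⌋, ?_⟩
    push_cast
    linarith
  · intro t ht s
    have h : ((t, p) : ℝ × ℝ × ℝ × (S → ℝ)).1 * (1 - ((t, p) : ℝ × ℝ × ℝ × (S → ℝ)).1) = 0 := ht
    simp only [deformX_of_eq_zero h, deformG_of_eq_zero h, and_self]

end GeneralPosition

section EngelLift

/-- The horizontal lift of the plane curve `(x, y)` starting at height `(z₀, w₀)`. -/
noncomputable def engelLift (x y : ℝ → ℝ) (z₀ w₀ s : ℝ) : ℝ × ℝ × ℝ × ℝ :=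
  (x s, y s, z₀ + moment x y 0 s,
    w₀ + (z₀ + moment x y 0 s) * x s - z₀ * x 0 - moment x y 1 s)

variable {x y : ℝ → ℝ}

theorem hasDerivAt_moment (hx : ContDiff ℝ ∞ x) (hy : Continuous y) (i : ℕ) (s : ℝ) :
    HasDerivAt (moment x y i) (y s * (x s ^ i * deriv x s)) s := by
  have hd := hx.deriv_infty.continuous
  have hc := hx.continuous
  exact hasDerivAt_primitive (f := fun u => y u * (x u ^ i * deriv x u)) (by fun_prop) s

theorem hasDerivAt_engelLift (hx : ContDiff ℝ ∞ x) (hy : ContDiff ℝ ∞ y) (z₀ w₀ s : ℝ) :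
    HasDerivAt (engelLift x y z₀ w₀) (deriv x s, deriv y s, y s * deriv x s,
      (z₀ + moment x y 0 s) * deriv x s) s := by
  have h0 := hasDerivAt_moment hx hy.continuous 0 s
  have h1 := hasDerivAt_moment hx hy.continuous 1 s
  have hxs : HasDerivAt x (deriv x s) s := (hx.differentiable (by simp) s).hasDerivAt
  have hys : HasDerivAt y (deriv y s) s := (hy.differentiable (by simp) s).hasDerivAt
  refine (hxs.prodMk (hys.prodMk ((h0.const_add z₀).prodMk
    (((((h0.const_add z₀).mul hxs).const_add w₀).sub_const (z₀ * x 0)).sub h1)))).congr_deriv ?_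
  simp only [Prod.mk.injEq, true_and]
  constructor <;> ring

theorem isHorizontalLoop_engelLift (hx : ContDiff ℝ ∞ x) (hy : ContDiff ℝ ∞ y)
    (hxp : Function.Periodic x 1) (hyp : Function.Periodic y 1)
    (hm0 : moment x y 0 1 = 0) (hm1 : moment x y 1 1 = 0)
    (himm : ∀ s, deriv x s = 0 → deriv y s ≠ 0)
    (hinj : ∀ a b, momentCurve x y b = momentCurve x y a → ∃ m : ℤ, b - a = m) (z₀ w₀ : ℝ) :
    IsHorizontalLoop (engelLift x y z₀ w₀) := by
  have hd := hasDerivAt_engelLift hx hy z₀ w₀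
  have hm : ∀ i, ContDiff ℝ ∞ (moment x y i) := fun i =>
    (contDiff_moment (Q := ℝ) (X := fun p => x p.2) (Y := fun p => y p.2) (by fun_prop)
      (by fun_prop) i).comp (contDiff_prodMk_right (0 : ℝ))
  have hfst : ∀ s, HasDerivAt (fun t => (engelLift x y z₀ w₀ t).1) (deriv x s) s := fun s =>
    (hx.differentiable (by simp) s).hasDerivAt
  have hz : ∀ s, HasDerivAt (fun t => (engelLift x y z₀ w₀ t).2.2.1) (y s * deriv x s) s :=
    fun s => ((hasDerivAt_moment hx hy.continuous 0 s).const_add z₀).congr_deriv (by ring)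
  have hw : ∀ s, HasDerivAt (fun t => (engelLift x y z₀ w₀ t).2.2.2)
      ((z₀ + moment x y 0 s) * deriv x s) s := fun s =>
    (((((hasDerivAt_moment hx hy.continuous 0 s).const_add z₀).mul (hfst s)).const_add
      w₀).sub_const (z₀ * x 0)).sub (hasDerivAt_moment hx hy.continuous 1 s) |>.congr_deriv
      (by simp only [engelLift]; ring)
  refine ⟨?_, fun s => ?_, fun s h => ?_, fun s => ?_, fun s => ?_, fun a b hab => ?_⟩
  · have := hm 0
    have := hm 1
    unfold engelLift
    fun_prop
  · have h := periodic_momentCurve hx hxp hy.continuous hyp hm0 hm1 s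
    simp only [momentCurve, Prod.mk.injEq] at h
    simp only [engelLift, h.1, h.2.1, h.2.2.1, h.2.2.2]
  · rw [(hd s).deriv] at h
    simp only [Prod.mk_eq_zero] at h
    exact himm s h.1 h.2.1
  · rw [(hfst s).deriv, (hz s).deriv]
    rfl
  · rw [(hfst s).deriv, (hw s).deriv]
    rfl
  · simp only [engelLift, Prod.mk.injEq, add_right_inj] at hab
    obtain ⟨h1, h2, h3, h4⟩ := hab
    refine hinj a b ?_
    rw [h1, h3] at h4
    simp only [momentCurve, Prod.mk.injEq]
    exact ⟨h1.symm, h2.symm, h3.symm, by linarith⟩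

theorem contDiff_engelLift_family {X Y : ℝ × ℝ → ℝ} (hX : ContDiff ℝ ∞ X) (hY : ContDiff ℝ ∞ Y)
    {z w : ℝ → ℝ} (hz : ContDiff ℝ ∞ z) (hw : ContDiff ℝ ∞ w) :
    ContDiff ℝ ∞ fun p : ℝ × ℝ =>
      engelLift (fun s => X (p.1, s)) (fun s => Y (p.1, s)) (z p.1) (w p.1) p.2 := by
  have h0 := contDiff_moment hX hY 0
  have h1 := contDiff_moment hX hY 1
  unfold engelLift
  fun_prop

theorem eq_sub_of_hasDerivAt {f g : ℝ → ℝ} {f' : ℝ → ℝ} (hf : ∀ s, HasDerivAt f (f' s) s)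
    (hg : ∀ s, HasDerivAt g (f' s) s) (s : ℝ) : f s - g s = f 0 - g 0 := by
  have h : ∀ s, HasDerivAt (fun s => f s - g s) 0 s := fun s =>
    ((hf s).sub (hg s)).congr_deriv (sub_self _)
  exact is_const_of_deriv_eq_zero (fun s => (h s).differentiableAt) (fun s => (h s).deriv) s 0

end EngelLift

section HorizontalLoop

variable {γ : ℝ → ℝ × ℝ × ℝ × ℝ}

theorem IsHorizontalLoop.contDiff_x (h : IsHorizontalLoop γ) :
    ContDiff ℝ ∞ fun s => (γ s).1 := h.smooth.fst

theorem IsHorizontalLoop.contDiff_y (h : IsHorizontalLoop γ) :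
    ContDiff ℝ ∞ fun s => (γ s).2.1 := h.smooth.snd.fst

theorem IsHorizontalLoop.periodic_x (h : IsHorizontalLoop γ) :
    Function.Periodic (fun s => (γ s).1) 1 := fun s => by simp only [h.periodic s]

theorem IsHorizontalLoop.periodic_y (h : IsHorizontalLoop γ) :
    Function.Periodic (fun s => (γ s).2.1) 1 := fun s => by simp only [h.periodic s]

theorem IsHorizontalLoop.moment_zero (h : IsHorizontalLoop γ) (s : ℝ) :
    moment (fun s => (γ s).1) (fun s => (γ s).2.1) 0 s = (γ s).2.2.1 - (γ 0).2.2.1 := by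
  have h1 := hasDerivAt_moment h.contDiff_x h.contDiff_y.continuous 0
  have h2 : ∀ s, HasDerivAt (fun s => (γ s).2.2.1) ((γ s).2.1 *
      ((γ s).1 ^ 0 * deriv (fun s => (γ s).1) s)) s := fun s => by
    rw [pow_zero, one_mul, ← h.tangent_z s]
    exact (h.smooth.snd.snd.fst.differentiable (by simp) s).hasDerivAt
  have h3 := eq_sub_of_hasDerivAt h1 h2 s
  have h4 : moment (fun s => (γ s).1) (fun s => (γ s).2.1) 0 0 = 0 := by simp [moment]
  linarith

theorem IsHorizontalLoop.moment_one (h : IsHorizontalLoop γ) (s : ℝ) :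
    moment (fun s => (γ s).1) (fun s => (γ s).2.1) 1 s =
      ((γ s).2.2.1 * (γ s).1 - (γ s).2.2.2) - ((γ 0).2.2.1 * (γ 0).1 - (γ 0).2.2.2) := by
  have h1 := hasDerivAt_moment h.contDiff_x h.contDiff_y.continuous 1
  have h2 : ∀ s, HasDerivAt (fun s => (γ s).2.2.1 * (γ s).1 - (γ s).2.2.2) ((γ s).2.1 *
      ((γ s).1 ^ 1 * deriv (fun s => (γ s).1) s)) s := fun s => by
    have hz := (h.smooth.snd.snd.fst.differentiable (by simp) s).hasDerivAt
    have hw := (h.smooth.snd.snd.snd.differentiable (by simp) s).hasDerivAt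
    have hx := (h.contDiff_x.differentiable (by simp) s).hasDerivAt
    rw [h.tangent_z s] at hz
    rw [h.tangent_w s] at hw
    exact ((hz.mul hx).sub hw).congr_deriv (by ring)
  have h3 := eq_sub_of_hasDerivAt h1 h2 s
  have h4 : moment (fun s => (γ s).1) (fun s => (γ s).2.1) 1 0 = 0 := by simp [moment]
  linarith

theorem IsHorizontalLoop.moment_zero_one (h : IsHorizontalLoop γ) :
    moment (fun s => (γ s).1) (fun s => (γ s).2.1) 0 1 = 0 := by
  rw [h.moment_zero, show γ 1 = γ 0 by simpa using h.periodic 0, sub_self]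

theorem IsHorizontalLoop.moment_one_one (h : IsHorizontalLoop γ) :
    moment (fun s => (γ s).1) (fun s => (γ s).2.1) 1 1 = 0 := by
  rw [h.moment_one, show γ 1 = γ 0 by simpa using h.periodic 0, sub_self]

theorem IsHorizontalLoop.engelLift_eq (h : IsHorizontalLoop γ) :
    engelLift (fun s => (γ s).1) (fun s => (γ s).2.1) (γ 0).2.2.1 (γ 0).2.2.2 = γ := by
  ext s : 1
  simp only [engelLift, h.moment_zero, h.moment_one]
  refine Prod.ext rfl (Prod.ext rfl (Prod.ext ?_ ?_)) <;> simp only <;> ring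

theorem IsHorizontalLoop.momentCurve_injective (h : IsHorizontalLoop γ) (a b : ℝ)
    (hab : momentCurve (fun s => (γ s).1) (fun s => (γ s).2.1) b =
      momentCurve (fun s => (γ s).1) (fun s => (γ s).2.1) a) : ∃ m : ℤ, b - a = m := by
  simp only [momentCurve, h.moment_zero, h.moment_one, Prod.mk.injEq] at hab
  obtain ⟨h1, h2, h3, h4⟩ := hab
  have h3' : (γ b).2.2.1 = (γ a).2.2.1 := by linarith
  rw [h1, h3'] at h4
  exact h.injOnPeriod a b (Prod.ext h1.symm (Prod.ext h2.symm (Prod.ext h3'.symm (by linarith))))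

theorem IsHorizontalLoop.sq_add_sq_pos (h : IsHorizontalLoop γ) (s : ℝ) :
    0 < deriv (fun t => (γ t).1) s ^ 2 + deriv (fun t => (γ t).2.1) s ^ 2 := by
  by_contra hn
  have h1 : deriv (fun t => (γ t).1) s = 0 := by
    nlinarith [sq_nonneg (deriv (fun t => (γ t).1) s), sq_nonneg (deriv (fun t => (γ t).2.1) s)]
  have h2 : deriv (fun t => (γ t).2.1) s = 0 := by
    nlinarith [sq_nonneg (deriv (fun t => (γ t).1) s), sq_nonneg (deriv (fun t => (γ t).2.1) s)]
  have hd := hasDerivAt_engelLift h.contDiff_x h.contDiff_y (γ 0).2.2.1 (γ 0).2.2.2 s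
  rw [h.engelLift_eq, h1, h2] at hd
  refine h.immersed s (hd.deriv.trans ?_)
  simp

theorem contDiff_of_cos_sin {θ : ℝ → ℝ} (hθ : Continuous θ)
    (hc : ContDiff ℝ ∞ fun s => Real.cos (θ s)) (hs : ContDiff ℝ ∞ fun s => Real.sin (θ s)) :
    ContDiff ℝ ∞ θ := by
  rw [contDiff_iff_contDiffAt]
  intro a
  have hnear : ∀ᶠ s in 𝓝 a, θ s - θ a ∈ Ioo (-(Real.pi / 2)) (Real.pi / 2) := by
    have : ContinuousAt (fun s => θ s - θ a) a := by fun_prop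
    refine this.eventually (Ioo_mem_nhds ?_ ?_) <;> simp [Real.pi_pos]
  have h1 : θ =ᶠ[𝓝 a] fun s => θ a + Real.arcsin
      (Real.sin (θ s) * Real.cos (θ a) - Real.cos (θ s) * Real.sin (θ a)) := by
    filter_upwards [hnear] with s h
    rw [← Real.sin_sub, Real.arcsin_sin h.1.le h.2.le]
    ring
  refine ContDiffAt.congr_of_eventuallyEq ?_ h1
  have harcsin : ContDiffAt ℝ ∞ Real.arcsin
      (Real.sin (θ a) * Real.cos (θ a) - Real.cos (θ a) * Real.sin (θ a)) := by
    apply Real.contDiffAt_arcsin <;> rw [← Real.sin_sub] <;> simp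
  have hsub : ContDiff ℝ ∞ fun s =>
      Real.sin (θ s) * Real.cos (θ a) - Real.cos (θ s) * Real.sin (θ a) := by fun_prop
  exact contDiffAt_const.add (ContDiffAt.comp (g := Real.arcsin) a harcsin hsub.contDiffAt)

theorem angle_add_one {θ : ℝ → ℝ} (hθ : ContDiff ℝ ∞ θ)
    (hc : ∀ s, Real.cos (θ (s + 1)) = Real.cos (θ s))
    (hs : ∀ s, Real.sin (θ (s + 1)) = Real.sin (θ s)) (s : ℝ) :
    θ (s + 1) - θ s = θ 1 - θ 0 := by
  have hd : ∀ s, HasDerivAt θ (deriv θ s) s := fun s =>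
    (hθ.differentiable (by simp) s).hasDerivAt
  have hd1 : ∀ s, HasDerivAt (fun s => θ (s + 1)) (deriv θ (s + 1)) s := fun s =>
    (hd (s + 1)).comp_add_const s 1
  have he : ∀ s, deriv θ (s + 1) = deriv θ s := by
    intro s
    have h1 := (hd1 s).sin.unique (by simpa only [hs] using (hd s).sin)
    have h2 := (hd1 s).cos.unique (by simpa only [hc] using (hd s).cos)
    rw [hc] at h1
    rw [hs] at h2
    have h3 := Real.cos_sq_add_sin_sq (θ s)
    linear_combination Real.cos (θ s) * h1 - Real.sin (θ s) * h2 -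
      (deriv θ (s + 1) - deriv θ s) * h3
  have h := eq_sub_of_hasDerivAt (fun s => (hd1 s).congr_deriv (he s)) hd s
  rwa [zero_add] at h

theorem IsHorizontalLoop.exists_smooth_angle (h : IsHorizontalLoop γ) {n : ℤ}
    (hr : HasRotationNumber γ n) : ∃ r θ : ℝ → ℝ, ContDiff ℝ ∞ θ ∧ (∀ s, 0 < r s) ∧
      (∀ s, deriv (fun t => (γ t).1) s = r s * Real.cos (θ s)) ∧
      (∀ s, deriv (fun t => (γ t).2.1) s = r s * Real.sin (θ s)) ∧
      ∀ s, θ (s + 1) = θ s + n * (2 * Real.pi) := by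
  obtain ⟨θ, hθc, hθ, hn⟩ := hr
  have hx := h.contDiff_x.deriv_infty
  have hy := h.contDiff_y.deriv_infty
  have hxp := h.periodic_x.deriv_one
  have hyp := h.periodic_y.deriv_one
  set r : ℝ → ℝ := fun s =>
    √(deriv (fun t => (γ t).1) s ^ 2 + deriv (fun t => (γ t).2.1) s ^ 2) with hrdef
  have hrpos : ∀ s, 0 < r s := fun s => Real.sqrt_pos.2 (h.sq_add_sq_pos s)
  have hrs : ContDiff ℝ ∞ r :=
    ContDiff.sqrt (by fun_prop) fun s => (h.sq_add_sq_pos s).ne'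
  have hrp : ∀ s, r (s + 1) = r s := fun s => by simp only [hrdef, hxp s, hyp s]
  have ec : ∀ s, Real.cos (θ s) = deriv (fun t => (γ t).1) s / r s := fun s =>
    (eq_div_iff (hrpos s).ne').2 (by rw [mul_comm]; exact (hθ s).1.symm)
  have es : ∀ s, Real.sin (θ s) = deriv (fun t => (γ t).2.1) s / r s := fun s =>
    (eq_div_iff (hrpos s).ne').2 (by rw [mul_comm]; exact (hθ s).2.symm)
  have hθs : ContDiff ℝ ∞ θ := by
    refine contDiff_of_cos_sin hθc ?_ ?_
    · simp only [ec]; exact hx.div hrs fun s => (hrpos s).ne'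
    · simp only [es]; exact hy.div hrs fun s => (hrpos s).ne'
  refine ⟨r, θ, hθs, hrpos, fun s => (hθ s).1, fun s => (hθ s).2, fun s => ?_⟩
  have := angle_add_one hθs (fun s => by rw [ec, ec, hxp s, hrp s])
    (fun s => by rw [es, es, hyp s, hrp s]) s
  linear_combination this + hn

end HorizontalLoop

/-- If two horizontal loops have equal rotation numbers, then there is a
horizontal isotopy between them. -/
theorem horizontal_isotopy_of_rot_eq
    (γ₀ γ₁ : ℝ → ℝ × ℝ × ℝ × ℝ) (n : ℤ)
    (h₀ : IsHorizontalLoop γ₀) (h₁ : IsHorizontalLoop γ₁)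
    (hr₀ : HasRotationNumber γ₀ n) (hr₁ : HasRotationNumber γ₁ n) :
    ∃ H : ℝ → ℝ → ℝ × ℝ × ℝ × ℝ,
      IsHorizontalIsotopy H ∧ H 0 = γ₀ ∧ H 1 = γ₁ := by
  obtain ⟨r₀, θ₀, hθ₀, hrp₀, hx₀, hy₀, hp₀⟩ := h₀.exists_smooth_angle hr₀
  obtain ⟨r₁, θ₁, hθ₁, hrp₁, hx₁, hy₁, hp₁⟩ := h₁.exists_smooth_angle hr₁
  obtain ⟨X, Y, hX, hY, hXp, hYp, himm, hX0, hY0, hX1, hY1⟩ := exists_regular_homotopy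
    h₀.contDiff_x h₀.contDiff_y h₁.contDiff_x h₁.contDiff_y hθ₀ hθ₁ h₀.periodic_x h₀.periodic_y
    h₁.periodic_x h₁.periodic_y hrp₀ hrp₁ hx₀ hy₀ hx₁ hy₁ hp₀ hp₁
  have hXt : ∀ t, ContDiff ℝ ∞ fun s => X (t, s) := fun t => by fun_prop
  have hYt : ∀ t, ContDiff ℝ ∞ fun s => Y (t, s) := fun t => by fun_prop
  have hdet : ∀ t, 0 < gramDet fun s => X (t, s) := fun t => by
    refine gramDet_pos (hXt t) (hXp t) ?_
    by_contra! hc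
    obtain ⟨s, hs⟩ := Function.Periodic.exists_deriv_eq_zero_of_one
      ((hYt t).differentiable (by simp)) (hYp t)
    exact himm t s (hc s) hs
  set G : ℝ × ℝ → ℝ := fun p => Y p / gramDet fun s => X (p.1, s) with hGdef
  have hdetC : ContDiff ℝ ∞ fun p : ℝ × ℝ => gramDet fun s => X (p.1, s) :=
    (contDiff_gramDet hX).comp contDiff_fst
  have hG : ContDiff ℝ ∞ G := hY.div hdetC fun p => (hdet p.1).ne'
  have hGt : ∀ t, ContDiff ℝ ∞ fun s => G (t, s) := fun t => by fun_prop
  have hGp : ∀ t, Function.Periodic (fun s => G (t, s)) 1 := fun t s => by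
    simp only [hGdef, hYp]
  have himmG : ∀ t s, deriv (fun s => X (t, s)) s = 0 →
      deriv (correct (fun s => X (t, s)) (fun s => G (t, s))) s ≠ 0 := fun t s hs => by
    rw [deriv_correct (hXt t) ((hGt t).differentiable (by simp)) hs]
    simp only [hGdef, deriv_div_const]
    exact mul_ne_zero (hdet t).ne' (div_ne_zero (himm t s hs) (hdet t).ne')
  have hends : ∀ t γ, IsHorizontalLoop γ → (∀ s, X (t, s) = (γ s).1) →
      (∀ s, Y (t, s) = (γ s).2.1) → ((fun s => X (t, s)) = fun s => (γ s).1) ∧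
      correct (fun s => X (t, s)) (fun s => G (t, s)) = fun s => (γ s).2.1 := by
    intro t γ h hx hy
    have hx' : (fun s => X (t, s)) = fun s => (γ s).1 := funext hx
    have hd := hdet t
    refine ⟨hx', ?_⟩
    simp only [hGdef, hy]
    rw [hx'] at hd ⊢
    exact correct_eq_of_moment_eq_zero hd.ne' h.moment_zero_one h.moment_one_one
  obtain ⟨ex0, ey0⟩ := hends 0 γ₀ h₀ hX0 hY0
  obtain ⟨ex1, ey1⟩ := hends 1 γ₁ h₁ hX1 hY1
  obtain ⟨X', Y', hX', hY', hXp', hYp', hm, himm', hinj', hend⟩ :=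
    exists_embedded_family hX hG hXp hGp himmG fun t ht a b hab => by
      rcases mul_eq_zero.1 ht with rfl | ht
      · rw [ey0, ex0] at hab
        exact h₀.momentCurve_injective a b hab
      · obtain rfl : t = 1 := by linarith
        rw [ey1, ex1] at hab
        exact h₁.momentCurve_injective a b hab
  refine ⟨fun t => engelLift (fun s => X' (t, s)) (fun s => Y' (t, s))
    ((1 - t) * (γ₀ 0).2.2.1 + t * (γ₁ 0).2.2.1) ((1 - t) * (γ₀ 0).2.2.2 + t * (γ₁ 0).2.2.2),
    ⟨ContDiff.contDiffOn (contDiff_engelLift_family hX' hY'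
      (z := fun t => (1 - t) * (γ₀ 0).2.2.1 + t * (γ₁ 0).2.2.1)
      (w := fun t => (1 - t) * (γ₀ 0).2.2.2 + t * (γ₁ 0).2.2.2) (by fun_prop) (by fun_prop)),
      fun t ht => ?_⟩, ?_, ?_⟩
  · exact isHorizontalLoop_engelLift (by fun_prop) (by fun_prop) (hXp' t) (hYp' t)
      (hm t 0 (by simp)) (hm t 1 (by simp)) (himm' t ht) (hinj' t ht) _ _
  · have e1 : (fun s => X' (0, s)) = fun s => (γ₀ s).1 := by
      rw [← ex0]; exact funext fun s => (hend 0 (by simp) s).1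
    have e2 : (fun s => Y' (0, s)) = fun s => (γ₀ s).2.1 := by
      rw [← ey0]; exact funext fun s => (hend 0 (by simp) s).2
    simp only [e1, e2, sub_zero, one_mul, zero_mul, add_zero]
    exact h₀.engelLift_eq
  · have e1 : (fun s => X' (1, s)) = fun s => (γ₁ s).1 := by
      rw [← ex1]; exact funext fun s => (hend 1 (by simp) s).1
    have e2 : (fun s => Y' (1, s)) = fun s => (γ₁ s).2.1 := by
      rw [← ey1]; exact funext fun s => (hend 1 (by simp) s).2
    simp only [e1, e2, sub_self, one_mul, zero_mul, zero_add]
    exact h₁.engelLift_eq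
end

section
/- Every integer is realised as the rotation number of a horizontal loop: for every n ∈ ℤ there exists a horizontal loop γ : ℝ → ℝ⁴ in the standard Engel space (ℝ⁴, 𝒟) with rot(γ) = n. -/
open Real

/-- Criterion for a curve to be a horizontal loop of rotation number `n`: the planar velocity
`(X, Y)`, rotated by `-φ`, avoids the closed negative real axis, for an angle `φ` which
turns `n` times. -/
theorem isHorizontalLoop_and_hasRotationNumber {x y z w X Y φ : ℝ → ℝ} {n : ℤ}
    (hx : ContDiff ℝ (⊤ : ℕ∞) x) (hy : ContDiff ℝ (⊤ : ℕ∞) y)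
    (hz : ContDiff ℝ (⊤ : ℕ∞) z) (hw : ContDiff ℝ (⊤ : ℕ∞) w)
    (hper : Function.Periodic (fun s => (x s, y s, z s, w s)) 1)
    (hX : ∀ s, HasDerivAt x (X s) s) (hY : ∀ s, HasDerivAt y (Y s) s)
    (hz' : ∀ s, HasDerivAt z (y s * X s) s) (hw' : ∀ s, HasDerivAt w (z s * X s) s)
    (hXc : Continuous X) (hYc : Continuous Y) (hX1 : X 1 = X 0) (hY1 : Y 1 = Y 0)
    (hinj : ∀ s t, x s = x t → y s = y t → z s = z t → ∃ k : ℤ, t - s = k)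
    (hφ : Continuous φ) (hφ1 : φ 1 = φ 0 + n * (2 * π))
    (hslit : ∀ s, 0 < X s * cos (φ s) + Y s * sin (φ s) ∨
      Y s * cos (φ s) - X s * sin (φ s) ≠ 0) :
    IsHorizontalLoop (fun s => (x s, y s, z s, w s)) ∧
      HasRotationNumber (fun s => (x s, y s, z s, w s)) n := by
  have dx : ∀ s, deriv (fun t => x t) s = X s := fun s => (hX s).deriv
  have dy : ∀ s, deriv (fun t => y t) s = Y s := fun s => (hY s).deriv
  refine ⟨⟨by fun_prop, hper, ?_, ?_, ?_, ?_⟩, ?_⟩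
  · intro s h
    rw [((hX s).prodMk ((hY s).prodMk ((hz' s).prodMk (hw' s)))).deriv] at h
    simp only [Prod.mk_eq_zero] at h
    have := hslit s
    simp [h.1, h.2.1] at this
  · intro s
    simpa only [dx] using (hz' s).deriv
  · intro s
    simpa only [dx] using (hw' s).deriv
  · intro s t h
    simp only [Prod.mk.injEq] at h
    exact hinj s t h.1 h.2.1 h.2.2.1
  · let V : ℝ → ℂ := fun s => ⟨X s * cos (φ s) + Y s * sin (φ s),
      Y s * cos (φ s) - X s * sin (φ s)⟩
    have hV : Continuous V := by
      have : V = fun s => ((X s * cos (φ s) + Y s * sin (φ s) : ℝ) : ℂ) +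
          ((Y s * cos (φ s) - X s * sin (φ s) : ℝ) : ℂ) * Complex.I := by
        funext s
        exact Complex.mk_eq_add_mul_I _ _
      rw [this]
      fun_prop
    refine ⟨fun s => φ s + (V s).arg, ?_, ?_, ?_⟩
    · refine hφ.add (continuous_iff_continuousAt.2 fun s => ?_)
      exact (Complex.continuousAt_arg (Complex.mem_slitPlane_iff.2 (hslit s))).comp
        hV.continuousAt
    · intro s
      simp only [dx, dy]
      have hnorm : √(X s ^ 2 + Y s ^ 2) = ‖V s‖ := by
        rw [Complex.norm_def, Complex.normSq_apply]
        congr 1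
        linear_combination (-(X s ^ 2 + Y s ^ 2)) * sin_sq_add_cos_sq (φ s)
      have hre := Complex.norm_mul_cos_arg (V s)
      have him := Complex.norm_mul_sin_arg (V s)
      simp only [V] at hre him
      rw [hnorm, cos_add, sin_add]
      constructor
      · linear_combination (-cos (φ s)) * hre + sin (φ s) * him -
          X s * sin_sq_add_cos_sq (φ s)
      · linear_combination (-sin (φ s)) * hre - cos (φ s) * him -
          Y s * sin_sq_add_cos_sq (φ s)
    · have : V 1 = V 0 := by
        simp only [V, hφ1, hX1, hY1, cos_add_int_mul_two_pi, sin_add_int_mul_two_pi]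
      simp only [this, hφ1]
      ring

theorem exists_int_sub_of_cos_eq_of_sin_eq {s t : ℝ} (hc : cos (2 * π * s) = cos (2 * π * t))
    (hs : sin (2 * π * s) = sin (2 * π * t)) : ∃ k : ℤ, t - s = k := by
  have h := Real.Angle.cos_sin_inj hc hs
  obtain ⟨k, hk⟩ := Real.Angle.angle_eq_iff_two_pi_dvd_sub.1 h
  refine ⟨-k, ?_⟩
  have := pi_pos
  have h2 : 2 * π * (t - s - ((-k : ℤ) : ℝ)) = 0 := by
    push_cast
    linarith
  have h3 := (mul_eq_zero.1 h2).resolve_left (by positivity)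
  linarith

/-- The reflection `(x, y, z, w) ↦ (x, -y, -z, -w)` negates the rotation number. -/
theorem exists_horizontalLoop_neg {n : ℤ}
    (h : ∃ γ : ℝ → ℝ × ℝ × ℝ × ℝ, IsHorizontalLoop γ ∧ HasRotationNumber γ n) :
    ∃ γ : ℝ → ℝ × ℝ × ℝ × ℝ, IsHorizontalLoop γ ∧ HasRotationNumber γ (-n) := by
  obtain ⟨γ, hγ, θ, hθ, hV, hθ1⟩ := h
  have hd : Differentiable ℝ γ := hγ.smooth.differentiable (by simp)
  have hsm := hγ.smooth
  refine ⟨fun s => ((γ s).1, -(γ s).2), ⟨?_, ?_, ?_, ?_, ?_, ?_⟩, fun s => -θ s, hθ.neg, ?_, ?_⟩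
  · fun_prop
  · intro s
    simp only [hγ.periodic s]
  · intro s h0
    apply hγ.immersed s
    have h1 : HasDerivAt (fun s => (γ s).1) (deriv γ s).1 s :=
      (hasFDerivAt_fst (𝕜 := ℝ) (p := γ s)).comp_hasDerivAt s (hd s).hasDerivAt
    have h2 : HasDerivAt (fun s => (γ s).2) (deriv γ s).2 s :=
      (hasFDerivAt_snd (𝕜 := ℝ) (p := γ s)).comp_hasDerivAt s (hd s).hasDerivAt
    rw [(h1.prodMk h2.fun_neg).deriv] at h0
    simp only [Prod.mk_eq_zero, neg_eq_zero] at h0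
    exact Prod.ext h0.1 h0.2
  · intro s
    have := hγ.tangent_z s
    simp only [Prod.snd_neg, Prod.fst_neg, deriv.fun_neg]
    linarith
  · intro s
    have := hγ.tangent_w s
    simp only [Prod.snd_neg, Prod.fst_neg, deriv.fun_neg]
    linarith
  · intro s t h
    simp only [Prod.mk.injEq, neg_inj] at h
    exact hγ.injOnPeriod s t (Prod.ext h.1 h.2)
  · intro s
    obtain ⟨h1, h2⟩ := hV s
    simp only [Prod.fst_neg, deriv.fun_neg, neg_sq, cos_neg, sin_neg]
    exact ⟨h1, by linarith⟩
  · push_cast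
    linarith

theorem hasDerivAt_sin_mul (a s : ℝ) : HasDerivAt (fun s => sin (a * s)) (a * cos (a * s)) s := by
  simpa [mul_comm] using ((hasDerivAt_id s).const_mul a).sin

theorem hasDerivAt_cos_mul (a s : ℝ) :
    HasDerivAt (fun s => cos (a * s)) (-(a * sin (a * s))) s := by
  simpa [mul_comm] using ((hasDerivAt_id s).const_mul a).cos

theorem cos_mul_int_periodic (m : ℤ) : Function.Periodic (fun s => cos (2 * π * m * s)) 1 := by
  intro s
  simp only
  rw [show 2 * π * m * (s + 1) = 2 * π * m * s + m * (2 * π) by ring, cos_add_int_mul_two_pi]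

theorem sin_mul_int_periodic (m : ℤ) : Function.Periodic (fun s => sin (2 * π * m * s)) 1 := by
  intro s
  simp only
  rw [show 2 * π * m * (s + 1) = 2 * π * m * s + m * (2 * π) by ring, sin_add_int_mul_two_pi]

theorem cos_two_pi_periodic : Function.Periodic (fun s => cos (2 * π * s)) 1 := by
  simpa using cos_mul_int_periodic 1

theorem sin_two_pi_periodic : Function.Periodic (fun s => sin (2 * π * s)) 1 := by
  simpa using sin_mul_int_periodic 1

/-- A loop over the planar curve `(sin T, sin 4T)`, with `T = 2πs`. -/
theorem exists_horizontalLoop_zero :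
    ∃ γ : ℝ → ℝ × ℝ × ℝ × ℝ, IsHorizontalLoop γ ∧ HasRotationNumber γ 0 := by
  let c : ℝ → ℝ := fun s => cos (2 * π * s)
  let S : ℝ → ℝ := fun s => sin (2 * π * s)
  have hc : ∀ s, HasDerivAt c (-(2 * π * S s)) s := hasDerivAt_cos_mul _
  have hS : ∀ s, HasDerivAt S (2 * π * c s) s := hasDerivAt_sin_mul _
  have cper : ∀ s, c (s + 1) = c s := cos_two_pi_periodic
  have sper : ∀ s, S (s + 1) = S s := sin_two_pi_periodic
  have c1 : c 1 = c 0 := by simpa using cper 0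
  have s1 : S 1 = S 0 := by simpa using sper 0
  have hcs : ∀ s, S s ^ 2 + c s ^ 2 = 1 := fun s => sin_sq_add_cos_sq _
  have hinj : ∀ s t, c s = c t → S s = S t → ∃ k : ℤ, t - s = k :=
    fun s t => exists_int_sub_of_cos_eq_of_sin_eq
  have csm : ContDiff ℝ (⊤ : ℕ∞) c := by fun_prop
  have ssm : ContDiff ℝ (⊤ : ℕ∞) S := by fun_prop
  clear_value c S
  have hpi := pi_pos
  refine ⟨_, isHorizontalLoop_and_hasRotationNumber
    (x := S) (y := fun s => 4 * S s * (2 * c s ^ 3 - c s))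
    (z := fun s => 4 / 3 * c s ^ 3 - 8 / 5 * c s ^ 5)
    (w := fun s => -(4 / 15) * S s * c s ^ 5)
    (X := fun s => 2 * π * c s)
    (Y := fun s => 2 * π * (4 * (8 * c s ^ 4 - 8 * c s ^ 2 + 1)))
    (φ := fun _ => π / 2) (n := 0) ssm (by fun_prop) (by fun_prop) (by fun_prop) ?_ hS
    ?_ ?_ ?_ (by fun_prop) (by fun_prop) (by simp only [c1]) (by simp only [c1]) ?_
    continuous_const (by simp) ?_⟩
  · intro s
    simp only [cper, sper]
  · intro s
    refine (((hS s).const_mul 4).mul ((((hc s).pow 3).const_mul 2).sub (hc s))).congr_deriv ?_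
    simp only [Pi.sub_apply, Pi.pow_apply]
    push_cast
    linear_combination (2 * π * (4 - 24 * c s ^ 2)) * hcs s
  · intro s
    refine ((((hc s).pow 3).const_mul (4 / 3)).sub (((hc s).pow 5).const_mul (8 / 5))).congr_deriv ?_
    push_cast
    ring
  · intro s
    refine (((hS s).const_mul (-(4 / 15))).mul ((hc s).pow 5)).congr_deriv ?_
    simp only [Pi.pow_apply]
    push_cast
    linear_combination (8 / 3 * π * c s ^ 4) * hcs s
  · intro s t hx hy hz
    have h2 : c s ^ 2 = c t ^ 2 := by linear_combination hcs s - hcs t - (S s + S t) * hx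
    rcases sq_eq_sq_iff_eq_or_eq_neg.1 h2 with h | h
    · exact hinj s t h hx
    · by_cases h0 : c s = 0
      · exact hinj s t (by linarith) hx
      · exfalso
        have h' : c t = -c s := by linarith
        rw [h', ← hx] at hy
        rw [h'] at hz
        have e1 : c s ^ 3 * (c s ^ 2 - 5 / 6) = 0 := by linear_combination (-5 / 16) * hz
        have e2 : c s ^ 2 = 5 / 6 := by
          linarith [(mul_eq_zero.1 e1).resolve_left (pow_ne_zero 3 h0)]
        have e3 : c s * S s = 0 := by linear_combination (3 / 16) * hy - 3 * S s * c s * e2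
        have e4 : c s ^ 2 * S s ^ 2 = 0 := by rw [← mul_pow, e3]; norm_num
        have := hcs s
        rw [e2] at e4
        linarith
  · intro s
    simp only [cos_pi_div_two, sin_pi_div_two]
    by_cases h0 : c s = 0
    · left
      rw [h0]
      norm_num
      exact hpi
    · right
      simp [h0, hpi.ne']

/-- The equations at a crossing of two branches of the planar curve
`(sin nT, cos 3nT + cos T / 10)` with opposite values of `c = cos nT` are inconsistent. -/
theorem false_of_crossing_equations {n c S a b : ℝ} (hn : 2 ≤ n) (hcs : S ^ 2 + c ^ 2 = 1)
    (ha : a ^ 2 ≤ 4) (hb : b ^ 2 ≤ 4) (hy : 2 * (c * (4 * c ^ 2 - 3)) = -(1 / 10 * a))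
    (hz : S * (6 * n ^ 2 * S ^ 2 - 2 * c ^ 2) = n * (1 / 10) * b) : False := by
  have hy2 : c ^ 2 * (4 * c ^ 2 - 3) ^ 2 = a ^ 2 / 400 := by
    linear_combination (c * (4 * c ^ 2 - 3) / 2 - a / 40) * hy
  have hz2 : S ^ 2 * (6 * n ^ 2 * S ^ 2 - 2 * c ^ 2) ^ 2 = n ^ 2 * b ^ 2 / 100 := by
    rw [← mul_pow, hz]
    ring
  have hq : c ^ 2 = 1 - S ^ 2 := by linarith
  rw [hq] at hy2 hz2
  generalize S ^ 2 = u at hy2 hz2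
  have hu : 1 / 5 ≤ u := by
    by_contra! hu
    have h5 : (1 / 5 : ℝ) ^ 2 ≤ (4 * (1 - u) - 3) ^ 2 :=
      pow_le_pow_left₀ (by norm_num) (by linarith) 2
    have := mul_le_mul (show 4 / 5 ≤ 1 - u by linarith) h5 (by norm_num) (by linarith)
    linarith
  have hnu := mul_nonneg (sub_nonneg.2 hu) (sq_nonneg n)
  have hB : 8 / 5 * n ≤ 6 * n ^ 2 * u - 2 * (1 - u) := by nlinarith
  have hB2 : (8 / 5 * n) ^ 2 ≤ (6 * n ^ 2 * u - 2 * (1 - u)) ^ 2 :=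
    pow_le_pow_left₀ (by linarith) hB 2
  have hL := mul_le_mul hu hB2 (sq_nonneg _) (by linarith)
  have hR := mul_le_mul_of_nonneg_left hb (sq_nonneg n)
  nlinarith

/-- The loops over the planar curves `(sin nT, cos 3nT + κ cos T)`, with `T = 2πs`. A nonzero `κ`
separates the `n` sheets of the curve when `n ≥ 2`. -/
theorem exists_horizontalLoop_of_parameters (n : ℤ) (κ η : ℝ) (hκη : η * ((n : ℝ) ^ 2 - 1) = κ)
    (h : n = 1 ∧ κ = 0 ∧ η = 0 ∨ 2 ≤ n ∧ κ = 1 / 10) :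
    ∃ γ : ℝ → ℝ × ℝ × ℝ × ℝ, IsHorizontalLoop γ ∧ HasRotationNumber γ n := by
  let c : ℝ → ℝ := fun s => cos (2 * π * n * s)
  let S : ℝ → ℝ := fun s => sin (2 * π * n * s)
  let C : ℝ → ℝ := fun s => cos (2 * π * s)
  let D : ℝ → ℝ := fun s => sin (2 * π * s)
  have hc : ∀ s, HasDerivAt c (-(2 * π * n * S s)) s := hasDerivAt_cos_mul _
  have hS : ∀ s, HasDerivAt S (2 * π * n * c s) s := hasDerivAt_sin_mul _
  have hC : ∀ s, HasDerivAt C (-(2 * π * D s)) s := hasDerivAt_cos_mul _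
  have hD : ∀ s, HasDerivAt D (2 * π * C s) s := hasDerivAt_sin_mul _
  have cper : ∀ s, c (s + 1) = c s := cos_mul_int_periodic n
  have sper : ∀ s, S (s + 1) = S s := sin_mul_int_periodic n
  have Cper : ∀ s, C (s + 1) = C s := cos_two_pi_periodic
  have Dper : ∀ s, D (s + 1) = D s := sin_two_pi_periodic
  have c1 : c 1 = c 0 := by simpa using cper 0
  have s1 : S 1 = S 0 := by simpa using sper 0
  have D1 : D 1 = D 0 := by simpa using Dper 0
  have hcs : ∀ s, S s ^ 2 + c s ^ 2 = 1 := fun s => sin_sq_add_cos_sq _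
  have hCD : ∀ s, D s ^ 2 + C s ^ 2 = 1 := fun s => sin_sq_add_cos_sq _
  have hinj : ∀ s t, C s = C t → D s = D t → ∃ k : ℤ, t - s = k :=
    fun s t => exists_int_sub_of_cos_eq_of_sin_eq
  have hone : n = 1 → c = C ∧ S = D := by
    rintro rfl
    simp [c, C, S, D]
  have hrefl : ∀ s t, C s = C t → (∃ k : ℤ, t - s = k) ∨ S t = - S s := by
    intro s t hst
    obtain ⟨k, hk | hk⟩ := Real.cos_eq_cos_iff.1 hst
    · left
      refine ⟨k, mul_left_cancel₀ (two_pi_pos.ne') ?_⟩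
      linarith
    · right
      simp only [S]
      rw [← sin_neg, ← sin_add_int_mul_two_pi (-(2 * π * n * s)) (k * n)]
      congr 1
      push_cast
      linear_combination n * hk
  have hcos : ∀ s, cos (2 * π * n * s) = c s := fun _ => rfl
  have hsin : ∀ s, sin (2 * π * n * s) = S s := fun _ => rfl
  have csm : ContDiff ℝ (⊤ : ℕ∞) c := by fun_prop
  have ssm : ContDiff ℝ (⊤ : ℕ∞) S := by fun_prop
  have Csm : ContDiff ℝ (⊤ : ℕ∞) C := by fun_prop
  have Dsm : ContDiff ℝ (⊤ : ℕ∞) D := by fun_prop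
  clear_value c S C D
  have hpi := pi_pos
  have hn1 : (1 : ℝ) ≤ n := by
    have : 1 ≤ n := by omega
    exact_mod_cast this
  obtain ⟨μ, hμ⟩ : ∃ μ : ℝ, η = μ * (4 * (n : ℝ) ^ 2 - 1) :=
    ⟨η / (4 * (n : ℝ) ^ 2 - 1), (div_mul_cancel₀ _ (by nlinarith)).symm⟩
  refine ⟨_, isHorizontalLoop_and_hasRotationNumber
    (x := S) (y := fun s => 4 * c s ^ 3 - 3 * c s + κ * C s)
    (z := fun s => S s * c s ^ 3 + η * n * (n * (S s * C s) - c s * D s))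
    (w := fun s => -(1 / 5) * c s ^ 5 + μ * n ^ 2 *
      (-(2 * n ^ 2 + 1) * (c s ^ 2 * C s) + -(3 * n) * (S s * (c s * D s)) + 3 * n ^ 2 * C s))
    (X := fun s => 2 * π * n * c s)
    (Y := fun s => 2 * π * (n * S s * (3 - 12 * c s ^ 2) - κ * D s))
    (φ := fun s => 2 * π * n * s) (n := n) ssm (by fun_prop) (by fun_prop) (by fun_prop) ?_ hS
    ?_ ?_ ?_ (by fun_prop) (by fun_prop) (by simp only [c1]) (by simp only [c1, s1, D1]) ?_
    (by fun_prop) (by ring) ?_⟩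
  · intro s
    simp only [cper, sper, Cper, Dper]
  · intro s
    refine (((((hc s).pow 3).const_mul 4).sub ((hc s).const_mul 3)).add
      ((hC s).const_mul κ)).congr_deriv ?_
    push_cast
    ring
  · intro s
    refine (((hS s).mul ((hc s).pow 3)).add (((((hS s).mul (hC s)).const_mul (n : ℝ)).sub
      ((hc s).mul (hD s))).const_mul (η * n))).congr_deriv ?_
    simp only [Pi.pow_apply]
    push_cast
    rw [← hκη]
    linear_combination (-6 * π * n * c s ^ 2) * hcs s
  · intro s
    refine ((((hc s).pow 5).const_mul (-(1 / 5))).add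
      ((((((hc s).pow 2).mul (hC s)).const_mul (-(2 * (n : ℝ) ^ 2 + 1))).add
        (((hS s).mul ((hc s).mul (hD s))).const_mul (-(3 * (n : ℝ))))).add
        ((hC s).const_mul (3 * (n : ℝ) ^ 2)) |>.const_mul
          (μ * n ^ 2))).congr_deriv ?_
    simp only [Pi.pow_apply, Pi.mul_apply]
    push_cast
    rw [hμ]
    linear_combination (6 * π * μ * n ^ 4 * D s) * hcs s
  · intro s t hx hy hz
    have h2 : c s ^ 2 = c t ^ 2 := by linear_combination hcs s - hcs t - (S s + S t) * hx
    have same : c s = c t → ∃ k : ℤ, t - s = k := by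
      intro hct
      rcases h with ⟨h1, -, -⟩ | ⟨h2n, hκ⟩
      · obtain ⟨rfl, rfl⟩ := hone h1
        exact hinj s t hct hx
      · rw [hct, hκ] at hy
        have hCt : C s = C t := by linarith
        rw [hct, hx, hCt] at hz
        have hη : η ≠ 0 := by
          rintro rfl
          norm_num [hκ] at hκη
        have e : η * n * (c t * (D s - D t)) = 0 := by linear_combination -hz
        have hne : η * (n : ℝ) ≠ 0 := mul_ne_zero hη (by linarith)
        rcases mul_eq_zero.1 ((mul_eq_zero.1 e).resolve_left hne) with e | e
        · rcases hrefl s t hCt with hk | hk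
          · exact hk
          · have := hcs t
            have hS0 : S t = 0 := by linarith
            rw [e, hS0] at this
            norm_num at this
        · exact hinj s t hCt (by linarith)
    rcases sq_eq_sq_iff_eq_or_eq_neg.1 h2 with hct | hct
    · exact same hct
    · by_cases h0 : c s = 0
      · exact same (by linarith)
      · exfalso
        have h' : c t = -c s := by linarith
        rw [h'] at hy
        rw [h', ← hx] at hz
        have ey : 2 * (c s * (4 * c s ^ 2 - 3)) = -(κ * (C s - C t)) := by linear_combination hy
        have ez : S s * (6 * n ^ 2 * S s ^ 2 - 2 * c s ^ 2) = n * κ * (D s + D t) := by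
          apply mul_left_cancel₀ h0
          rw [← hκη] at ey ⊢
          linear_combination ((n : ℝ) ^ 2 - 1) * hz - n ^ 2 * S s * ey +
            6 * n ^ 2 * c s * S s * hcs s
        have hs1 := hcs s
        rcases h with ⟨-, hκ, hη⟩ | ⟨h2n, hκ⟩
        · rw [hη] at hz
          rw [hκ] at ey
          have e1 : S s * c s ^ 3 = 0 := by linear_combination hz / 2
          have e2 : S s = 0 := (mul_eq_zero.1 e1).resolve_right (pow_ne_zero 3 h0)
          have e3 : c s * (4 * c s ^ 2 - 3) = 0 := by linear_combination ey / 2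
          have e4 := (mul_eq_zero.1 e3).resolve_left h0
          rw [e2] at hs1
          linarith
        · have hn2 : (2 : ℝ) ≤ n := by exact_mod_cast h2n
          have hCC : (C s - C t) ^ 2 ≤ 4 := by
            nlinarith [hCD s, hCD t, sq_nonneg (D s), sq_nonneg (D t), sq_nonneg (C s + C t)]
          have hDD : (D s + D t) ^ 2 ≤ 4 := by
            nlinarith [hCD s, hCD t, sq_nonneg (C s), sq_nonneg (C t), sq_nonneg (D s - D t)]
          rw [hκ] at ey ez
          exact false_of_crossing_equations hn2 hs1 hCC hDD ey ez
  · intro s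
    simp only [hcos, hsin]
    by_cases h0 : c s = 0
    · left
      have hS1 : S s ^ 2 = 1 := by simpa [h0] using hcs s
      have hD1 : D s ^ 2 ≤ 1 := by nlinarith [hCD s, sq_nonneg (C s)]
      have hκ : κ = 0 ∨ κ = 1 / 10 := by tauto
      have hDS : D s * S s ≤ 1 := by nlinarith [sq_nonneg (D s - S s)]
      have : 0 < 3 * n - κ * (D s * S s) := by
        rcases hκ with rfl | rfl <;> linarith
      rw [h0]
      have : 0 < 2 * π * (3 * n - κ * (D s * S s)) := by positivity
      linear_combination this + (-6 * π * n) * hS1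
    · by_cases him : 2 * π * (n * S s * (3 - 12 * c s ^ 2) - κ * D s) * c s -
          2 * π * n * c s * S s = 0
      · left
        have e : 2 * π * (n * S s * (3 - 12 * c s ^ 2) - κ * D s) = 2 * π * n * S s := by
          apply mul_right_cancel₀ h0
          linarith
        rw [e]
        have : 0 < 2 * π * (n : ℝ) := by positivity
        linear_combination this + (-2 * π * n) * hcs s
      · exact Or.inr him

/-- Every integer is realised as the rotation number of a horizontal loop. -/
theorem exists_horizontal_loop_with_rot (n : ℤ) :
    ∃ γ : ℝ → ℝ × ℝ × ℝ × ℝ, IsHorizontalLoop γ ∧ HasRotationNumber γ n := by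
  have pos : ∀ m : ℤ, 0 < m →
      ∃ γ : ℝ → ℝ × ℝ × ℝ × ℝ, IsHorizontalLoop γ ∧ HasRotationNumber γ m := by
    intro m hm
    rcases (show m = 1 ∨ 2 ≤ m by omega) with rfl | h2
    · exact exists_horizontalLoop_of_parameters 1 0 0 (by simp) (by simp)
    · have : (2 : ℝ) ≤ m := by exact_mod_cast h2
      have hne : (m : ℝ) ^ 2 - 1 ≠ 0 := by nlinarith
      exact exists_horizontalLoop_of_parameters m (1 / 10) (1 / 10 / ((m : ℝ) ^ 2 - 1))
        (div_mul_cancel₀ _ hne) (Or.inr ⟨h2, rfl⟩)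
  rcases lt_trichotomy n 0 with hn | rfl | hn
  · simpa using exists_horizontalLoop_neg (pos (-n) (by omega))
  · exact exists_horizontalLoop_zero
  · exact pos n hn
end
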